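/- arXiv:1205.4089 — 3 statements merged into one kernel-verified Lean document; each statement's English description precedes it below -/
import Mathlib

section
/- If S satisfies the non-degeneracy condition (ND), then the set G_N(Θ) = { Σ_{j=1}^N v_j ΔS_j : v ∈ Θ } of terminal gains of admissible strategies is a closed subspace of L²(Ω,F,P). -/
open MeasureTheory
open scoped Topology

/-- The sum of two closed subspaces that make a positive angle is closed. -/
theorem Submodule.isClosed_sup_of_neg_le_inner {H : Type*} [NormedAddCommGroup H]
    [InnerProductSpace ℝ H] [CompleteSpace H] {K V : Submodule ℝ H}
    (hK : IsClosed (K : Set H)) (hV : IsClosed (V : Set H)) {c : ℝ} (hc : c < 1)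
    (h : ∀ g ∈ K, ∀ f ∈ V, -(c * (‖g‖ ^ 2 + ‖f‖ ^ 2)) ≤ 2 * inner ℝ g f) :
    IsClosed ((K ⊔ V : Submodule ℝ H) : Set H) := by
  have := hK.completeSpace_coe
  have := hV.completeSpace_coe
  have hanti : AntilipschitzWith (Real.toNNReal (√(1 - c))⁻¹) (K.subtypeL.coprod V.subtypeL) := by
    refine AddMonoidHomClass.antilipschitz_of_bound _ fun ⟨⟨g, hg⟩, ⟨f, hf⟩⟩ ↦ ?_
    have hpos : 0 < √(1 - c) := Real.sqrt_pos.2 (by linarith)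
    have hsq : √(1 - c) ^ 2 = 1 - c := Real.sq_sqrt (by linarith)
    have hbound : (1 - c) * (‖g‖ ^ 2 + ‖f‖ ^ 2) ≤ ‖g + f‖ ^ 2 := by
      rw [norm_add_sq_real]
      linarith [h g hg f hf]
    rw [Real.coe_toNNReal _ (by positivity), inv_mul_eq_div, le_div_iff₀' hpos]
    simp only [ContinuousLinearMap.coprod_apply, Submodule.subtypeL_apply, Prod.norm_mk,
      Submodule.coe_norm]
    refine le_of_sq_le_sq ?_ (norm_nonneg _)
    rw [mul_pow, hsq]
    refine le_trans (mul_le_mul_of_nonneg_left ?_ (by linarith)) hbound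
    rcases max_choice ‖g‖ ‖f‖ with h | h <;> rw [h] <;> nlinarith [sq_nonneg ‖g‖, sq_nonneg ‖f‖]
  have hrange : Set.range (K.subtypeL.coprod V.subtypeL) = ((K ⊔ V : Submodule ℝ H) : Set H) := by
    ext x
    simp [Submodule.mem_sup]
  rw [← hrange]
  exact hanti.isClosed_range (K.subtypeL.coprod V.subtypeL).uniformContinuous

section Gains

variable {Ω : Type*} {m m' m0 : MeasurableSpace Ω}

/-- The square-integrable gains `v * X` over one period with price increment `X`, where the
position `v` is `m`-measurable. -/
def onePeriodGains (P : Measure Ω) (m : MeasurableSpace Ω) (X : Ω → ℝ) :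
    Submodule ℝ (Lp ℝ 2 P) where
  carrier := {g | ∃ v : Ω → ℝ, StronglyMeasurable[m] v ∧ (g : Ω → ℝ) =ᵐ[P] fun ω ↦ v ω * X ω}
  zero_mem' := ⟨fun _ ↦ 0, stronglyMeasurable_const, by
    filter_upwards [Lp.coeFn_zero ℝ 2 P] with ω h
    simpa using h⟩
  add_mem' := by
    rintro f g ⟨v, hv, hfv⟩ ⟨w, hw, hgw⟩
    refine ⟨fun ω ↦ v ω + w ω, hv.add hw, ?_⟩
    filter_upwards [Lp.coeFn_add f g, hfv, hgw] with ω h h₁ h₂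
    rw [h, Pi.add_apply, h₁, h₂, add_mul]
  smul_mem' := by
    rintro c f ⟨v, hv, hfv⟩
    refine ⟨fun ω ↦ c * v ω, hv.const_mul c, ?_⟩
    filter_upwards [Lp.coeFn_smul c f, hfv] with ω h h₁
    rw [h, Pi.smul_apply, h₁, smul_eq_mul, mul_assoc]

theorem mem_onePeriodGains {P : Measure Ω} {X : Ω → ℝ} {g : Lp ℝ 2 P} :
    g ∈ onePeriodGains P m X ↔
      ∃ v : Ω → ℝ, StronglyMeasurable[m] v ∧ (g : Ω → ℝ) =ᵐ[P] fun ω ↦ v ω * X ω :=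
  Iff.rfl

theorem isClosed_onePeriodGains (P : Measure Ω) (m : MeasurableSpace Ω) (X : Ω → ℝ) :
    IsClosed (onePeriodGains P m X : Set (Lp ℝ 2 P)) := by
  refine IsSeqClosed.isClosed fun f g hf hfg ↦ ?_
  choose v hv hfv using fun n ↦ mem_onePeriodGains.1 (hf n)
  obtain ⟨ns, -, hns⟩ := (tendstoInMeasure_of_tendsto_Lp hfg).exists_seq_tendsto_ae
  refine mem_onePeriodGains.2 ⟨fun ω ↦ Filter.limUnder Filter.atTop fun n ↦ v (ns n) ω,
    StronglyMeasurable.limUnder fun n ↦ hv (ns n), ?_⟩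
  filter_upwards [hns, ae_all_iff.2 hfv] with ω hω hfvω
  simp only [hfvω] at hω
  by_cases hX : X ω = 0
  · simp only [hX, mul_zero] at hω ⊢
    exact tendsto_nhds_unique hω tendsto_const_nhds
  · have hlim : Filter.Tendsto (fun n ↦ v (ns n) ω) Filter.atTop (𝓝 (g ω / X ω)) := by
      simpa [hX] using hω.div_const (X ω)
    rw [hlim.limUnder_eq, div_mul_cancel₀ _ hX]

theorem onePeriodGains_le_lpMeas {P : Measure Ω} (hm : m ≤ m') {X : Ω → ℝ}
    (hX : StronglyMeasurable[m'] X) :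
    onePeriodGains P m X ≤ lpMeas ℝ ℝ m' 2 P := by
  rintro g ⟨v, hv, hgv⟩
  exact mem_lpMeas_iff_aestronglyMeasurable.2 ⟨_, (hv.mono hm).mul hX, hgv⟩

/-- Under the non-degeneracy condition, the angle between the `m`-measurable random variables and
the gains over a period starting at `m` is bounded away from zero. -/
theorem neg_le_inner_of_mem_onePeriodGains {P : Measure Ω} [IsFiniteMeasure P]
    (hm : m ≤ m0) {X : Ω → ℝ} (hX : MemLp X 2 P) {δ : ℝ} (hδ : 0 < δ)
    (hND : ∀ᵐ ω ∂P, (P[X|m] ω) ^ 2 ≤ δ * P[fun ω' ↦ X ω' ^ 2|m] ω)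
    {g f : Lp ℝ 2 P} (hg : g ∈ lpMeas ℝ ℝ m 2 P) (hf : f ∈ onePeriodGains P m X) :
    -(√δ * (‖g‖ ^ 2 + ‖f‖ ^ 2)) ≤ 2 * inner ℝ g f := by
  obtain ⟨u, hu, hgu⟩ := mem_lpMeas_iff_aestronglyMeasurable.1 hg
  obtain ⟨v, hv, hfv⟩ := hf
  have hu2 : MemLp u 2 P := (memLp_congr_ae hgu).1 (Lp.memLp g)
  have hvX2 : MemLp (fun ω ↦ v ω * X ω) 2 P := (memLp_congr_ae hfv).1 (Lp.memLp f)
  have hnorm_g : ‖g‖ ^ 2 = ∫ ω, u ω ^ 2 ∂P := by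
    rw [← real_inner_self_eq_norm_sq, L2.inner_def]
    refine integral_congr_ae ?_
    filter_upwards [hgu] with ω h
    simp [h, sq]
  have hnorm_f : ‖f‖ ^ 2 = ∫ ω, (v * v * fun ω ↦ X ω ^ 2) ω ∂P := by
    rw [← real_inner_self_eq_norm_sq, L2.inner_def]
    refine integral_congr_ae ?_
    filter_upwards [hfv] with ω h
    simp only [h, real_inner_self_eq_norm_sq, Real.norm_eq_abs, sq_abs, Pi.mul_apply]
    ring
  have hinner : inner ℝ g f = ∫ ω, (u * v * X) ω ∂P := by
    rw [L2.inner_def]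
    refine integral_congr_ae ?_
    filter_upwards [hgu, hfv] with ω h₁ h₂
    simp [h₁, h₂]
    ring
  have hint_uvX : Integrable (u * v * X) P := by
    rw [mul_assoc]
    exact hu2.integrable_mul hvX2
  have hint_vvXX : Integrable (v * v * fun ω ↦ X ω ^ 2) P := by
    refine hvX2.integrable_sq.congr (.of_forall fun ω ↦ ?_)
    simp
    ring
  have hpull_X := condExp_mul_of_stronglyMeasurable_left (hu.mul hv) hint_uvX
    (hX.integrable one_le_two)
  have hpull_XX := condExp_mul_of_stronglyMeasurable_left (hv.mul hv) hint_vvXX hX.integrable_sq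
  have hint_X : Integrable (P[u * v * X|m]) P := integrable_condExp
  have hint_XX : Integrable (P[v * v * fun ω ↦ X ω ^ 2|m]) P := integrable_condExp
  rw [hnorm_g, hnorm_f, hinner, ← integral_condExp hm (f := v * v * fun ω ↦ X ω ^ 2),
    ← integral_condExp hm (f := u * v * X),
    ← integral_add hu2.integrable_sq hint_XX, ← integral_const_mul, ← integral_const_mul,
    ← integral_neg]
  refine integral_mono_ae ((hu2.integrable_sq.add hint_XX).const_mul _).neg
    (hint_X.const_mul _) ?_
  filter_upwards [hND, hpull_X, hpull_XX] with ω hω h₁ h₂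
  simp only [h₁, h₂, Pi.mul_apply]
  have hpos : 0 < √δ := Real.sqrt_pos.2 hδ
  have hsq : √δ * √δ = δ := Real.mul_self_sqrt hδ.le
  have hv2 := mul_le_mul_of_nonneg_left hω (sq_nonneg (v ω))
  refine le_of_mul_le_mul_left ?_ hpos
  linear_combination sq_nonneg (√δ * u ω + v ω * P[X|m] ω) + hv2 -
    v ω ^ 2 * P[fun ω' ↦ X ω' ^ 2|m] ω * hsq

variable {P : Measure Ω} {𝓕 : Filtration ℕ m0} {S : ℕ → Ω → ℝ}

theorem iSup_onePeriodGains_le_lpMeas (hadapt : StronglyAdapted 𝓕 S) (n : ℕ) :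
    ⨆ k ∈ Finset.Icc 1 n, onePeriodGains P (𝓕 (k - 1)) (fun ω ↦ S k ω - S (k - 1) ω) ≤
      lpMeas ℝ ℝ (𝓕 n) 2 P := by
  refine iSup₂_le fun k hk ↦ onePeriodGains_le_lpMeas (𝓕.mono ?_) ?_
  · grind
  · exact ((hadapt k).mono (𝓕.mono (by grind))).sub ((hadapt (k - 1)).mono (𝓕.mono (by grind)))

theorem isClosed_iSup_onePeriodGains [IsFiniteMeasure P] (hadapt : StronglyAdapted 𝓕 S)
    (hL2 : ∀ k, MemLp (S k) 2 P) {δ : ℝ} (hδ : 0 < δ) (hδ1 : δ < 1) (n : ℕ)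
    (hND : ∀ k, 1 ≤ k → k ≤ n → ∀ᵐ ω ∂P,
      (P[fun ω' ↦ S k ω' - S (k - 1) ω'|𝓕 (k - 1)] ω) ^ 2 ≤
        δ * P[fun ω' ↦ (S k ω' - S (k - 1) ω') ^ 2|𝓕 (k - 1)] ω) :
    IsClosed ((⨆ k ∈ Finset.Icc 1 n,
      onePeriodGains P (𝓕 (k - 1)) (fun ω ↦ S k ω - S (k - 1) ω) : Submodule ℝ (Lp ℝ 2 P)) :
        Set (Lp ℝ 2 P)) := by
  induction n with
  | zero => simp
  | succ n ih =>
    have hIcc : Finset.Icc 1 (n + 1) = insert (n + 1) (Finset.Icc 1 n) := by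
      ext k
      simp
      omega
    rw [hIcc, Finset.iSup_insert, sup_comm]
    refine Submodule.isClosed_sup_of_neg_le_inner (c := √δ)
      (ih fun k h₁ h₂ ↦ hND k h₁ (by omega)) (isClosed_onePeriodGains _ _ _)
      ((Real.sqrt_lt' one_pos).2 (by linarith)) fun g hg f hf ↦ ?_
    exact neg_le_inner_of_mem_onePeriodGains (𝓕.le (n + 1 - 1)) ((hL2 (n + 1)).sub (hL2 n)) hδ
      (hND (n + 1) (by omega) le_rfl) (iSup_onePeriodGains_le_lpMeas hadapt n hg) hf

end Gains

/-- If `S` satisfies the non-degeneracy condition (ND), then the set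
`G_N(Θ) = { Σ_{j=1}^N v_j ΔS_j : v ∈ Θ }` of terminal gains of admissible strategies is a
closed subset of `L²(Ω, F, P)`.  Here `Θ` is the set of predictable processes `v`
(`v_k` is `F_{k-1}`-measurable) with `v_k ΔS_k ∈ L²` for `k = 1,…,N`. -/
theorem stmt_1 {Ω : Type*} {m0 : MeasurableSpace Ω} (P : Measure Ω) [IsProbabilityMeasure P]
    (N : ℕ) (hN : 1 ≤ N) (𝓕 : Filtration ℕ m0)
    (S : ℕ → Ω → ℝ) (hadapt : StronglyAdapted 𝓕 S) (hL2 : ∀ k, MemLp (S k) 2 P)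
    (hND : ∃ δ : ℝ, 0 < δ ∧ δ < 1 ∧ ∀ k, 1 ≤ k → k ≤ N →
        ∀ᵐ ω ∂P,
          (condExp (𝓕 (k - 1)) P (fun ω' => S k ω' - S (k - 1) ω') ω) ^ 2
            ≤ δ * condExp (𝓕 (k - 1)) P (fun ω' => (S k ω' - S (k - 1) ω') ^ 2) ω) :
    IsClosed {g : Lp ℝ 2 P |
      ∃ v : ℕ → Ω → ℝ,
        (∀ k, 1 ≤ k → k ≤ N → StronglyMeasurable[𝓕 (k - 1)] (v k)) ∧
        (∀ k, 1 ≤ k → k ≤ N →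
          MemLp (fun ω => v k ω * (S k ω - S (k - 1) ω)) 2 P) ∧
        (g : Ω → ℝ) =ᵐ[P]
          fun ω => ∑ j ∈ Finset.Icc 1 N, v j ω * (S j ω - S (j - 1) ω)} := by
  obtain ⟨δ, hδ, hδ1, hND⟩ := hND
  convert isClosed_iSup_onePeriodGains hadapt hL2 hδ hδ1 N hND using 1
  ext g
  simp only [Set.mem_ofPred_eq, SetLike.mem_coe, Submodule.mem_iSup_finset_iff_exists_sum]
  constructor
  · rintro ⟨v, hv, hvL2, hg⟩
    have hmem : ∀ k, ∃ f : onePeriodGains P (𝓕 (k - 1)) (fun ω ↦ S k ω - S (k - 1) ω),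
        k ∈ Finset.Icc 1 N → (f : Lp ℝ 2 P) =ᵐ[P] fun ω ↦ v k ω * (S k ω - S (k - 1) ω) := by
      intro k
      by_cases hk : k ∈ Finset.Icc 1 N
      · obtain ⟨h₁, h₂⟩ := Finset.mem_Icc.1 hk
        have hcoe := (hvL2 k h₁ h₂).coeFn_toLp
        exact ⟨⟨(hvL2 k h₁ h₂).toLp _, v k, hv k h₁ h₂, hcoe⟩, fun _ ↦ hcoe⟩
      · exact ⟨0, fun h ↦ absurd h hk⟩
    choose f hf using hmem
    refine ⟨f, Lp.ext ?_⟩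
    have hall := (Finset.eventually_all (Finset.Icc 1 N)).2 hf
    filter_upwards [Lp.coeFn_fun_finsetSum (Finset.Icc 1 N) fun k ↦ (f k : Lp ℝ 2 P), hg, hall]
      with ω h₁ h₂ h₃
    rw [h₁, h₂]
    exact Finset.sum_congr rfl h₃
  · rintro ⟨f, rfl⟩
    choose v hv hfv using fun k ↦ mem_onePeriodGains.1 (f k).2
    refine ⟨v, fun k _ _ ↦ hv k, fun k _ _ ↦ (memLp_congr_ae (hfv k)).1 (Lp.memLp _), ?_⟩
    filter_upwards [Lp.coeFn_fun_finsetSum (Finset.Icc 1 N) fun k ↦ (f k : Lp ℝ 2 P),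
      ae_all_iff.2 hfv] with ω h₁ h₂
    rw [h₁]
    exact Finset.sum_congr rfl fun k _ ↦ h₂ k
end

section
/- Explicit discrete Föllmer–Schweizer decomposition of power payoffs: under Assumption A, let z ∈ D be such that 2 Re(z) ∈ D. Define g(z,n) = (m(z+1,n) − m(1,n) m(z,n))/(m(2,n) − m(1,n)²), h(z,n) = ∏_{i=n+1}^N ( m(z,i) − g(z,i)(m(1,i) − 1) ), H(z)_n = h(z,n) S_n^z, ξ(z)_n = g(z,n) h(z,n) S_{n−1}^{z−1}, and L(z)_n = H(z)_n − H(z)_0 − Σ_{k=1}^n ξ(z)_k ΔS_k. Then H(z)_N = S_N^z, each L(z)_n is square-integrable, L(z) is a complex martingale with L(z)_0 = 0, the product L(z)·M is a martingale (strong orthogonality to the martingale part M of S), and H(z)_n = H(z)_0 + Σ_{k=1}^n ξ(z)_k ΔS_k + L(z)_n for all n; i.e. S_N^z admits the discrete FS decomposition (H(z)_0, ξ(z), L(z)). -/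
open MeasureTheory ProbabilityTheory

section IndependentFactor

variable {Ω 𝕜 : Type*} [RCLike 𝕜] {m₁ m0 : MeasurableSpace Ω} {P : Measure Ω} {D : Ω → ℝ}

lemma indepFun_comp_of_indep_comap {β γ : Type*} [MeasurableSpace β] [MeasurableSpace γ]
    (hind : Indep m₁ (MeasurableSpace.comap D inferInstance) P)
    {A : Ω → β} {φ : ℝ → γ} (hA : Measurable[m₁] A) (hφ : Measurable φ) :
    IndepFun A (fun ω => φ (D ω)) P := by
  rw [IndepFun_iff_Indep]
  refine indep_of_indep_of_le_left (indep_of_indep_of_le_right hind ?_) hA.comap_le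
  exact (hφ.comp (comap_measurable D)).comap_le

lemma integrable_mul_of_indep_comap
    (hind : Indep m₁ (MeasurableSpace.comap D inferInstance) P)
    {A : Ω → 𝕜} {φ : ℝ → 𝕜} (hA : StronglyMeasurable[m₁] A) (hφ : Measurable φ)
    (hAi : Integrable A P) (hφi : Integrable (fun ω => φ (D ω)) P) :
    Integrable (fun ω => A ω * φ (D ω)) P :=
  (indepFun_comp_of_indep_comap hind hA.measurable hφ).integrable_mul hAi hφi

lemma condExp_mul_of_indep_comap [IsProbabilityMeasure P] (hm : m₁ ≤ m0) (hD : Measurable D)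
    (hind : Indep m₁ (MeasurableSpace.comap D inferInstance) P)
    {A : Ω → 𝕜} {φ : ℝ → 𝕜} (hA : StronglyMeasurable[m₁] A) (hφ : Measurable φ)
    (hAi : Integrable A P) (hφi : Integrable (fun ω => φ (D ω)) P) :
    P[fun ω => A ω * φ (D ω) | m₁] =ᵐ[P] fun ω => A ω * ∫ ω', φ (D ω') ∂P := by
  have h₁ := condExp_bilin_of_stronglyMeasurable_left (m := m₁) (μ := P)
    (ContinuousLinearMap.mul ℝ 𝕜) hA
    (integrable_mul_of_indep_comap hind hA hφ hAi hφi) hφi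
  have h₂ : P[fun ω => φ (D ω) | m₁] =ᵐ[P] fun _ => ∫ ω', φ (D ω') ∂P :=
    condExp_indep_eq hD.comap_le hm
      (hφ.comp (comap_measurable D)).stronglyMeasurable hind.symm
  filter_upwards [h₁, h₂] with ω h₁ h₂
  simpa [h₂] using h₁

lemma memLp_two_mul_of_indep_comap (hm : m₁ ≤ m0) (hD : Measurable D)
    (hind : Indep m₁ (MeasurableSpace.comap D inferInstance) P)
    {A : Ω → 𝕜} {φ : ℝ → 𝕜} (hA : StronglyMeasurable[m₁] A) (hφ : Measurable φ)
    (hA2 : MemLp A 2 P) (hφ2 : MemLp (fun ω => φ (D ω)) 2 P) :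
    MemLp (fun ω => A ω * φ (D ω)) 2 P := by
  have hAm := (hA.mono hm).measurable
  have hφm := hφ.comp hD
  rw [memLp_two_iff_integrable_sq_norm
    (show Measurable fun ω => A ω * φ (D ω) from hAm.mul hφm).aestronglyMeasurable]
  rw [memLp_two_iff_integrable_sq_norm hA2.1] at hA2
  rw [memLp_two_iff_integrable_sq_norm hφ2.1] at hφ2
  simp only [norm_mul, mul_pow]
  exact integrable_mul_of_indep_comap (A := fun ω => ‖A ω‖ ^ 2) (φ := fun x => ‖φ x‖ ^ 2)
    hind (hA.norm.pow 2) (hφ.norm.pow_const 2) hA2 hφ2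

lemma condExp_add_mul_of_indep_comap [IsProbabilityMeasure P] (hm : m₁ ≤ m0)
    (hD : Measurable D) (hind : Indep m₁ (MeasurableSpace.comap D inferInstance) P)
    {U A : Ω → 𝕜} {φ : ℝ → 𝕜} (hU : StronglyMeasurable[m₁] U) (hUi : Integrable U P)
    (hA : StronglyMeasurable[m₁] A) (hφ : Measurable φ)
    (hAi : Integrable A P) (hφi : Integrable (fun ω => φ (D ω)) P)
    (hφ0 : ∫ ω, φ (D ω) ∂P = 0) :
    P[fun ω => U ω + A ω * φ (D ω) | m₁] =ᵐ[P] U := by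
  have h₁ := condExp_add hUi (integrable_mul_of_indep_comap hind hA hφ hAi hφi) m₁
  have h₂ := condExp_mul_of_indep_comap hm hD hind hA hφ hAi hφi
  rw [condExp_of_stronglyMeasurable hm hU hUi] at h₁
  filter_upwards [h₁, h₂] with ω h₁ h₂
  rw [Pi.add_apply, h₂, hφ0, mul_zero, add_zero] at h₁
  exact h₁

/-- The one-step computation behind strong orthogonality: if `φ (D)`, `ψ (D)` and `φ (D) ψ (D)` are
centred and `D` is independent of the past, then the product of the two processes has no drift. -/
lemma condExp_mul_add_mul_of_indep_comap [IsProbabilityMeasure P] (hm : m₁ ≤ m0)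
    (hD : Measurable D) (hind : Indep m₁ (MeasurableSpace.comap D inferInstance) P)
    {U V A B : Ω → 𝕜} {φ ψ : ℝ → 𝕜}
    (hU : StronglyMeasurable[m₁] U) (hV : StronglyMeasurable[m₁] V)
    (hA : StronglyMeasurable[m₁] A) (hB : StronglyMeasurable[m₁] B)
    (hφ : Measurable φ) (hψ : Measurable ψ)
    (hU2 : MemLp U 2 P) (hV2 : MemLp V 2 P) (hA2 : MemLp A 2 P) (hB2 : MemLp B 2 P)
    (hφ2 : MemLp (fun ω => φ (D ω)) 2 P) (hψ2 : MemLp (fun ω => ψ (D ω)) 2 P)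
    (hφ0 : ∫ ω, φ (D ω) ∂P = 0) (hψ0 : ∫ ω, ψ (D ω) ∂P = 0)
    (hφψ : ∫ ω, φ (D ω) * ψ (D ω) ∂P = 0) :
    P[fun ω => (U ω + A ω * φ (D ω)) * (V ω + B ω * ψ (D ω)) | m₁]
      =ᵐ[P] fun ω => U ω * V ω := by
  have hφi := hφ2.integrable one_le_two
  have hψi := hψ2.integrable one_le_two
  have hφψi := hφ2.integrable_mul hψ2
  have iUV := hU2.integrable_mul hV2
  have iUB := hU2.integrable_mul hB2
  have iAV := hA2.integrable_mul hV2
  have iAB := hA2.integrable_mul hB2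
  have e₁ := condExp_add_mul_of_indep_comap hm hD hind (hU.mul hV) iUV (hA.mul hV) hφ iAV hφi hφ0
  have e₂ := condExp_mul_of_indep_comap hm hD hind (hU.mul hB) hψ iUB hψi
  have e₃ := condExp_mul_of_indep_comap (φ := fun x => φ x * ψ x) hm hD hind (hA.mul hB)
    (hφ.mul hψ) iAB hφψi
  have j₁ := integrable_mul_of_indep_comap hind (hA.mul hV) hφ iAV hφi
  have j₂ := integrable_mul_of_indep_comap hind (hU.mul hB) hψ iUB hψi
  have j₃ := integrable_mul_of_indep_comap (φ := fun x => φ x * ψ x) hind (hA.mul hB)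
    (hφ.mul hψ) iAB hφψi
  have a₁ := condExp_add ((iUV.add j₁).add j₂) j₃ m₁
  have a₂ := condExp_add (iUV.add j₁) j₂ m₁
  have hsplit : (fun ω => (U ω + A ω * φ (D ω)) * (V ω + B ω * ψ (D ω))) =
      (U * V + fun ω => (A * V) ω * φ (D ω)) + (fun ω => (U * B) ω * ψ (D ω)) +
        fun ω => (A * B) ω * (φ (D ω) * ψ (D ω)) := by
    ext ω
    simp only [Pi.add_apply, Pi.mul_apply]
    ring
  rw [hsplit]
  filter_upwards [e₁, e₂, e₃, a₁, a₂] with ω e₁ e₂ e₃ a₁ a₂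
  rw [a₁, Pi.add_apply, a₂, Pi.add_apply, e₂, e₃, hψ0, hφψ, mul_zero, mul_zero, add_zero, add_zero]
  exact e₁

end IndependentFactor

lemma condExp_ae_eq_of_forall_succ {Ω E : Type*} [NormedAddCommGroup E] [NormedSpace ℝ E]
    [CompleteSpace E] {m0 : MeasurableSpace Ω} {P : Measure Ω} [IsFiniteMeasure P]
    {𝓕 : Filtration ℕ m0} {N : ℕ} {Q : ℕ → Ω → E}
    (hQ : ∀ n ≤ N, StronglyMeasurable[𝓕 n] (Q n)) (hQi : ∀ n ≤ N, Integrable (Q n) P)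
    (hstep : ∀ n < N, P[Q (n + 1) | 𝓕 n] =ᵐ[P] Q n) {i j : ℕ} (hij : i ≤ j) (hj : j ≤ N) :
    P[Q j | 𝓕 i] =ᵐ[P] Q i := by
  induction j, hij using Nat.le_induction with
  | base => rw [condExp_of_stronglyMeasurable (𝓕.le i) (hQ i hj) (hQi i hj)]
  | succ n hn ih =>
    calc P[Q (n + 1) | 𝓕 i]
      _ =ᵐ[P] P[P[Q (n + 1) | 𝓕 n] | 𝓕 i] :=
        (condExp_condExp_of_le (𝓕.mono hn) (𝓕.le n)).symm
      _ =ᵐ[P] P[Q n | 𝓕 i] := condExp_congr_ae (hstep n hj)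
      _ =ᵐ[P] Q i := ih (by omega)

/-- Exponential moments of a process with independent increments at time `N` are inherited by the
earlier values and by the increments. -/
lemma integrable_exp_of_indep_increments {Ω : Type*} {m0 : MeasurableSpace Ω} {P : Measure Ω}
    [IsProbabilityMeasure P] {𝓕 : Filtration ℕ m0} {X : ℕ → Ω → ℝ} {N : ℕ}
    (hX : ∀ n, Measurable (X n)) (hXa : StronglyAdapted 𝓕 X)
    (hind : ∀ n < N, Indep (𝓕 n)
      (MeasurableSpace.comap (fun ω => X (n + 1) ω - X n ω) inferInstance) P)
    {a : ℝ} (ha : Integrable (fun ω => Real.exp (a * X N ω)) P) :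
    (∀ n ≤ N, Integrable (fun ω => Real.exp (a * X n ω)) P) ∧
      ∀ n < N, Integrable (fun ω => Real.exp (a * (X (n + 1) ω - X n ω))) P := by
  have hsplit : ∀ n < N, Integrable (fun ω => Real.exp (a * X (n + 1) ω)) P →
      Integrable (fun ω => Real.exp (a * X n ω)) P ∧
        Integrable (fun ω => Real.exp (a * (X (n + 1) ω - X n ω))) P := by
    intro n hn hi
    have hmeas : Measurable fun x : ℝ => Real.exp (a * x) := by fun_prop
    have hif := indepFun_comp_of_indep_comap (hind n hn)
      (hmeas.comp (hXa n).measurable) hmeas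
    have hi' : Integrable (fun ω => Real.exp (a * X n ω) *
        Real.exp (a * (X (n + 1) ω - X n ω))) P := by
      refine hi.congr (.of_forall fun ω => ?_)
      simp only [← Real.exp_add]
      ring_nf
    have hne : ∀ Y : Ω → ℝ, ¬ (fun ω => Real.exp (Y ω)) =ᵐ[P] 0 := fun Y hY => by
      obtain ⟨ω, hω⟩ := hY.exists
      exact (Real.exp_pos _).ne' hω
    have m₁ : Measurable fun ω => Real.exp (a * X n ω) := hmeas.comp (hX n)
    have m₂ : Measurable fun ω => Real.exp (a * (X (n + 1) ω - X n ω)) :=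
      hmeas.comp ((hX (n + 1)).sub (hX n))
    exact ⟨hif.integrable_left_of_integrable_op (· * ·) 1 one_ne_zero (by simp [enorm_mul]) hi'
        m₁.aestronglyMeasurable m₂.aestronglyMeasurable (hne _),
      hif.integrable_right_of_integrable_op (· * ·) 1 one_ne_zero (by simp [enorm_mul]) hi'
        m₁.aestronglyMeasurable m₂.aestronglyMeasurable (hne _)⟩
  have hval : ∀ n ≤ N, Integrable (fun ω => Real.exp (a * X n ω)) P := fun n hn =>
    Nat.decreasingInduction (motive := fun n _ => Integrable (fun ω => Real.exp (a * X n ω)) P)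
      (fun k hk ih => (hsplit k hk ih).1) ha hn
  exact ⟨hval, fun n hn => (hsplit n hn (hval (n + 1) hn)).2⟩

lemma memLp_two_cexp {Ω : Type*} {m0 : MeasurableSpace Ω} {P : Measure Ω} {Y : Ω → ℝ}
    (hY : Measurable Y) {w : ℂ} (hi : Integrable (fun ω => Real.exp (2 * w.re * Y ω)) P) :
    MemLp (fun ω => Complex.exp (w * Y ω)) 2 P := by
  rw [memLp_two_iff_integrable_sq_norm (by fun_prop)]
  refine hi.congr (.of_forall fun ω => ?_)
  simp only [Complex.norm_exp, Complex.re_mul_ofReal, ← Real.exp_nat_mul]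
  push_cast
  ring_nf

/-- The exponential of a random variable that is not almost surely constant has nonzero variance. -/
lemma integral_exp_two_mul_sub_sq_ne_zero {Ω : Type*} {m0 : MeasurableSpace Ω} {P : Measure Ω}
    [IsProbabilityMeasure P] {Y : Ω → ℝ} (hY : Measurable Y)
    (hc : ¬ ∃ c : ℝ, Y =ᵐ[P] fun _ => c)
    (hi : Integrable (fun ω => Real.exp (2 * Y ω)) P) :
    (∫ ω, Real.exp (2 * Y ω) ∂P) - (∫ ω, Real.exp (Y ω) ∂P) ^ 2 ≠ 0 := by
  have hsq : ∀ ω, Real.exp (Y ω) ^ 2 = Real.exp (2 * Y ω) := fun ω => by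
    rw [← Real.exp_nat_mul]; norm_num
  have hL2 : MemLp (fun ω => Real.exp (Y ω)) 2 P := by
    rw [memLp_two_iff_integrable_sq (by fun_prop)]
    simpa only [hsq] using hi
  intro h0
  have hvar : Var[fun ω => Real.exp (Y ω); P] = 0 := by
    rw [variance_eq_sub hL2]
    simpa only [Pi.pow_apply, hsq] using h0
  refine hc ⟨Real.log (∫ ω, Real.exp (Y ω) ∂P), ?_⟩
  filter_upwards [ae_eq_integral_of_variance_eq_zero hL2 hvar] with ω hω
  rw [← hω, Real.log_exp]

/-- The residual of the linear regression of `E` on `F` is centred. -/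
lemma integral_regression_residual {Ω : Type*} {m0 : MeasurableSpace Ω} {P : Measure Ω}
    [IsProbabilityMeasure P] {E F : Ω → ℂ} (hE : Integrable E P) (hF : Integrable F P) (c : ℂ) :
    ∫ ω, (E ω - ∫ ω', E ω' ∂P) - c * (F ω - ∫ ω', F ω' ∂P) ∂P = 0 := by
  rw [integral_sub (by fun_prop) (by fun_prop), integral_const_mul,
    integral_sub hE (integrable_const _), integral_sub hF (integrable_const _)]
  simp

/-- The residual of the linear regression of `E` on `F` is uncorrelated with `F`. -/
lemma integral_regression_residual_mul {Ω : Type*} {m0 : MeasurableSpace Ω} {P : Measure Ω}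
    [IsProbabilityMeasure P] {E F : Ω → ℂ} (hE : MemLp E 2 P) (hF : MemLp F 2 P) {c : ℂ}
    (hc : c * ((∫ ω, F ω * F ω ∂P) - (∫ ω, F ω ∂P) ^ 2) =
      (∫ ω, E ω * F ω ∂P) - (∫ ω, F ω ∂P) * ∫ ω, E ω ∂P) :
    ∫ ω, ((E ω - ∫ ω', E ω' ∂P) - c * (F ω - ∫ ω', F ω' ∂P)) * (F ω - ∫ ω', F ω' ∂P) ∂P = 0 := by
  have hEi := hE.integrable one_le_two
  have hFi := hF.integrable one_le_two
  have hEF : Integrable (fun ω => E ω * F ω) P := hE.integrable_mul hF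
  have hFF : Integrable (fun ω => F ω * F ω) P := hF.integrable_mul hF
  set a := ∫ ω, E ω ∂P with ha
  set b := ∫ ω, F ω ∂P with hb
  have hexpand : ∀ ω, ((E ω - a) - c * (F ω - b)) * (F ω - b) =
      E ω * F ω - c * (F ω * F ω) + (c * b * 2 - a) * F ω - b * E ω + (a * b - c * b * b) :=
    fun ω => by ring
  simp only [hexpand]
  rw [integral_add, integral_sub, integral_add, integral_sub, integral_const_mul,
    integral_const_mul, integral_const_mul, ← ha, ← hb]
  · simp only [integral_const, probReal_univ, one_smul]
    linear_combination -hc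
  all_goals fun_prop

lemma ofReal_mul_exp_cpow {s : ℝ} (hs : 0 < s) (x : ℝ) (w : ℂ) :
    ((s * Real.exp x : ℝ) : ℂ) ^ w = (s : ℂ) ^ w * Complex.exp (w * x) := by
  rw [Complex.ofReal_mul, Complex.mul_cpow_ofReal_nonneg hs.le (Real.exp_pos x).le,
    Complex.cpow_def_of_ne_zero (x := (Real.exp x : ℂ)) (by exact_mod_cast (Real.exp_pos x).ne'),
    ← Complex.ofReal_log (Real.exp_pos x).le, Real.log_exp, mul_comm (x : ℂ)]

/-- Explicit discrete Föllmer–Schweizer decomposition of the power payoff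
`S_N^z`.  Under Assumption A, let `z ∈ D` with `2 Re(z) ∈ D`.  With
`g(z,n) = (m(z+1,n) − m(1,n)m(z,n))/(m(2,n) − m(1,n)²)`,
`h(z,n) = ∏_{i=n+1}^N (m(z,i) − g(z,i)(m(1,i) − 1))`, `H(z)_n = h(z,n) S_n^z`,
`ξ(z)_n = g(z,n)h(z,n) S_{n-1}^{z-1}`, `L(z)_n = H(z)_n − H(z)_0 − Σ_{k=1}^n ξ(z)_k ΔS_k`,
one has: `H(z)_N = S_N^z`, each `L(z)_n` is square-integrable, `L(z)` is a complex martingale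
with `L(z)_0 = 0`, the product `L(z)·M` is a martingale (strong orthogonality to the
martingale part `M` of `S`), and `H(z)_n = H(z)_0 + Σ_{k=1}^n ξ(z)_k ΔS_k + L(z)_n`. -/
theorem stmt_7 {Ω : Type*} {m0 : MeasurableSpace Ω} (P : Measure Ω) [IsProbabilityMeasure P]
    (N : ℕ) (hN : 1 ≤ N) (𝓕 : Filtration ℕ m0)
    (X : ℕ → Ω → ℝ) (hXmeas : ∀ n, Measurable (X n)) (hX0 : ∀ ω, X 0 ω = 0)
    (hXadapted : StronglyAdapted 𝓕 X)
    (hindep : iIndepFun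
      (fun (k : Fin N) (ω : Ω) => X (k.val + 1) ω - X k.val ω) P)
    (hindep𝓕 : ∀ n, 1 ≤ n → n ≤ N →
      Indep (𝓕 (n - 1))
        (MeasurableSpace.comap (fun ω => X n ω - X (n - 1) ω) inferInstance) P)
    (s0 : ℝ) (hs0 : 0 < s0)
    (S : ℕ → Ω → ℝ) (hS : ∀ n ω, S n ω = s0 * Real.exp (X n ω))
    (D : Set ℂ)
    (hD : D = {w : ℂ | Integrable (fun ω => Complex.exp (w * X N ω)) P})
    -- Assumption A
    (hA1 : ∀ n, 1 ≤ n → n ≤ N →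
      ¬ ∃ c : ℝ, (fun ω => X n ω - X (n - 1) ω) =ᵐ[P] fun _ => c)
    (hA2 : (2 : ℂ) ∈ D)
    -- the chosen exponent
    (z : ℂ) (hz : z ∈ D) (h2Rez : ((2 * z.re : ℝ) : ℂ) ∈ D)
    -- discrete cumulant generating function and the FS-decomposition ingredients
    (m : ℂ → ℕ → ℂ)
    (hm : ∀ w n, m w n = ∫ ω, Complex.exp (w * (X n ω - X (n - 1) ω)) ∂P)
    (g : ℂ → ℕ → ℂ)
    (hg : ∀ w n, g w n = (m (w + 1) n - m 1 n * m w n) / (m 2 n - (m 1 n) ^ 2))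
    (h : ℂ → ℕ → ℂ)
    (hh : ∀ w n, h w n = ∏ i ∈ Finset.Icc (n + 1) N, (m w i - g w i * (m 1 i - 1)))
    (Hz : ℕ → Ω → ℂ) (hHz : ∀ n ω, Hz n ω = h z n * (S n ω : ℂ) ^ z)
    (ξ : ℕ → Ω → ℂ)
    (hξ : ∀ n ω, ξ n ω = g z n * h z n * (S (n - 1) ω : ℂ) ^ (z - 1))
    (L : ℕ → Ω → ℂ)
    (hL : ∀ n ω, L n ω = Hz n ω - Hz 0 ω -
        ∑ k ∈ Finset.Icc 1 n, ξ k ω * ((S k ω : ℂ) - (S (k - 1) ω : ℂ)))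
    -- the Doob decomposition martingale part of S
    (M : ℕ → Ω → ℝ)
    (hM : ∀ n ω, M n ω = S n ω -
        ∑ k ∈ Finset.Icc 1 n,
          condExp (𝓕 (k - 1)) P (fun ω' => S k ω' - S (k - 1) ω') ω) :
    -- terminal value
    (∀ ω, Hz N ω = (S N ω : ℂ) ^ z)
    -- square-integrability of L(z)
    ∧ (∀ n, n ≤ N → MemLp (L n) 2 P)
    -- L(z)_0 = 0
    ∧ (∀ ω, L 0 ω = 0)
    -- L(z) is a martingale (up to time N)
    ∧ (∀ n, n ≤ N → StronglyMeasurable[𝓕 n] (L n))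
    ∧ (∀ i j, i ≤ j → j ≤ N → condExp (𝓕 i) P (L j) =ᵐ[P] L i)
    -- L(z) · M is a martingale (strong orthogonality)
    ∧ (∀ i j, i ≤ j → j ≤ N →
        condExp (𝓕 i) P (fun ω => L j ω * (M j ω : ℂ)) =ᵐ[P] fun ω => L i ω * (M i ω : ℂ))
    -- the decomposition identity
    ∧ (∀ n, n ≤ N → ∀ ω,
        Hz n ω = Hz 0 ω +
          ∑ k ∈ Finset.Icc 1 n, ξ k ω * ((S k ω : ℂ) - (S (k - 1) ω : ℂ)) + L n ω) := by
  subst hD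
  have hsucc : ∀ n < N, Indep (𝓕 n)
      (MeasurableSpace.comap (fun ω => X (n + 1) ω - X n ω) inferInstance) P :=
    fun n hn => hindep𝓕 (n + 1) (by omega) hn
  have hdm : ∀ n, Measurable fun ω => X (n + 1) ω - X n ω :=
    fun n => (hXmeas (n + 1)).sub (hXmeas n)
  -- exponential moments
  have hmom : ∀ a : ℝ, ((a : ℝ) : ℂ) ∈ {w : ℂ | Integrable (fun ω => Complex.exp (w * X N ω)) P} →
      Integrable (fun ω => Real.exp (a * X N ω)) P := by
    intro a ha
    refine ha.norm.congr (.of_forall fun ω => ?_)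
    simp [Complex.norm_exp]
  obtain ⟨hX2, hd2⟩ := integrable_exp_of_indep_increments hXmeas hXadapted hsucc
    (hmom 2 (by exact_mod_cast hA2))
  obtain ⟨hXz, hdz⟩ := integrable_exp_of_indep_increments hXmeas hXadapted hsucc
    (hmom (2 * z.re) h2Rez)
  have hEz : ∀ n < N, MemLp (fun ω => Complex.exp (z * (X (n + 1) ω - X n ω : ℝ))) 2 P :=
    fun n hn => memLp_two_cexp (hdm n) (hdz n hn)
  have hE1 : ∀ n < N, MemLp (fun ω => Complex.exp (1 * (X (n + 1) ω - X n ω : ℝ))) 2 P :=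
    fun n hn => memLp_two_cexp (hdm n) (by simpa using hd2 n hn)
  have hm' : ∀ w n, m w (n + 1) = ∫ ω, Complex.exp (w * (X (n + 1) ω - X n ω : ℝ)) ∂P := by
    intro w n
    rw [hm]
    push_cast
    rfl
  -- the regression coefficient
  have hgm : ∀ n < N, g z (n + 1) * (m 2 (n + 1) - m 1 (n + 1) ^ 2) =
      m (z + 1) (n + 1) - m 1 (n + 1) * m z (n + 1) := by
    intro n hn
    have hne : m 2 (n + 1) - m 1 (n + 1) ^ 2 ≠ 0 := by
      have := integral_exp_two_mul_sub_sq_ne_zero (hdm n) (hA1 (n + 1) (by omega) hn) (hd2 n hn)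
      rw [hm', hm']
      have e₁ : ∀ ω, Complex.exp (1 * (X (n + 1) ω - X n ω : ℝ)) =
          (Real.exp (X (n + 1) ω - X n ω) : ℂ) := fun ω => by push_cast; ring_nf
      have e₂ : ∀ ω, Complex.exp (2 * (X (n + 1) ω - X n ω : ℝ)) =
          (Real.exp (2 * (X (n + 1) ω - X n ω)) : ℂ) := fun ω => by push_cast; ring_nf
      simp only [e₁, e₂, integral_complex_ofReal]
      exact_mod_cast this
    rw [hg, div_mul_cancel₀ _ hne]
  let φ : ℕ → ℝ → ℂ := fun n x => (Complex.exp (z * x) - m z (n + 1)) -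
    g z (n + 1) * (Complex.exp (1 * x) - m 1 (n + 1))
  let ψ : ℕ → ℝ → ℂ := fun n x => Complex.exp (1 * x) - m 1 (n + 1)
  have hφm : ∀ n, Measurable (φ n) := fun n => by fun_prop
  have hψm : ∀ n, Measurable (ψ n) := fun n => by fun_prop
  have hψ2 : ∀ n < N, MemLp (fun ω => ψ n (X (n + 1) ω - X n ω)) 2 P :=
    fun n hn => (hE1 n hn).sub (memLp_const _)
  have hφ2 : ∀ n < N, MemLp (fun ω => φ n (X (n + 1) ω - X n ω)) 2 P :=
    fun n hn => ((hEz n hn).sub (memLp_const _)).sub ((hψ2 n hn).const_mul _)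
  have hφ0 : ∀ n < N, ∫ ω, φ n (X (n + 1) ω - X n ω) ∂P = 0 := by
    intro n hn
    simp only [φ, hm']
    exact integral_regression_residual ((hEz n hn).integrable one_le_two)
      ((hE1 n hn).integrable one_le_two) _
  have hψ0 : ∀ n < N, ∫ ω, ψ n (X (n + 1) ω - X n ω) ∂P = 0 := by
    intro n hn
    simp only [ψ, hm']
    rw [integral_sub ((hE1 n hn).integrable one_le_two) (integrable_const _)]
    simp
  have hφψ : ∀ n < N,
      ∫ ω, φ n (X (n + 1) ω - X n ω) * ψ n (X (n + 1) ω - X n ω) ∂P = 0 := by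
    intro n hn
    have hgn := hgm n hn
    simp only [hm' 1 n, hm' z n, hm' 2 n, hm' (z + 1) n] at hgn
    simp only [φ, ψ, hm' 1 n, hm' z n]
    refine integral_regression_residual_mul (hEz n hn) (hE1 n hn) ?_
    simp only [← Complex.exp_add, ← add_mul]
    rw [one_add_one_eq_two]
    exact hgn
  -- powers of the price
  have hSpow : ∀ w n ω, (S n ω : ℂ) ^ w = (s0 : ℂ) ^ w * Complex.exp (w * X n ω) :=
    fun w n ω => by rw [hS, ofReal_mul_exp_cpow hs0]
  have hXm𝓕 : ∀ n, Measurable[𝓕 n] (X n) := fun n => (hXadapted n).measurable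
  have hSz𝓕 : ∀ n, StronglyMeasurable[𝓕 n] fun ω => (S n ω : ℂ) ^ z := by
    intro n
    simp only [hSpow]
    have hf : Measurable fun x : ℝ => (s0 : ℂ) ^ z * Complex.exp (z * x) := by fun_prop
    exact (hf.comp (hXm𝓕 n)).stronglyMeasurable
  have hS𝓕 : ∀ n, StronglyMeasurable[𝓕 n] (S n) := by
    intro n
    have hf : Measurable fun x : ℝ => s0 * Real.exp x := by fun_prop
    rw [show S n = fun ω => s0 * Real.exp (X n ω) from funext (hS n)]
    exact (hf.comp (hXm𝓕 n)).stronglyMeasurable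
  have hSz2 : ∀ n ≤ N, MemLp (fun ω => (S n ω : ℂ) ^ z) 2 P := by
    intro n hn
    simp only [hSpow]
    exact (memLp_two_cexp (hXmeas n) (hXz n hn)).const_mul _
  have hSC2 : ∀ n ≤ N, MemLp (fun ω => (S n ω : ℂ)) 2 P := by
    intro n hn
    have := (memLp_two_cexp (w := 1) (hXmeas n) (by simpa using hX2 n hn)).const_mul (s0 : ℂ)
    refine this.ae_eq (.of_forall fun ω => ?_)
    simp [hS]
  have hS2 : ∀ n ≤ N, MemLp (S n) 2 P := fun n hn => by simpa using (hSC2 n hn).re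
  -- increments
  have hSstep : ∀ n ω, S (n + 1) ω = S n ω * Real.exp (X (n + 1) ω - X n ω) := by
    intro n ω
    rw [hS, hS, mul_assoc, ← Real.exp_add]
    ring_nf
  have hSzstep : ∀ n ω, (S (n + 1) ω : ℂ) ^ z =
      (S n ω : ℂ) ^ z * Complex.exp (z * (X (n + 1) ω - X n ω : ℝ)) := by
    intro n ω
    rw [hSpow, hSpow, mul_assoc, ← Complex.exp_add]
    push_cast
    ring_nf
  have hhstep : ∀ n < N, h z n =
      (m z (n + 1) - g z (n + 1) * (m 1 (n + 1) - 1)) * h z (n + 1) := by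
    intro n hn
    rw [hh, hh, ← Finset.mul_prod_Ioc_eq_prod_Icc (by omega),
      Finset.Icc_add_one_left_eq_Ioc (n + 1)]
  have hLstep : ∀ n < N, ∀ ω, L (n + 1) ω =
      L n ω + h z (n + 1) * (S n ω : ℂ) ^ z * φ n (X (n + 1) ω - X n ω) := by
    intro n hn ω
    have hSne : (S n ω : ℂ) ≠ 0 := by
      rw [hS]
      exact_mod_cast (mul_pos hs0 (Real.exp_pos _)).ne'
    have hpow : (S n ω : ℂ) ^ (z - 1) * S n ω = (S n ω : ℂ) ^ z := by
      rw [Complex.cpow_sub _ _ hSne, Complex.cpow_one, div_mul_cancel₀ _ hSne]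
    rw [hL, hL, Finset.sum_Icc_succ_top (by omega), hHz (n + 1), hHz n, hξ (n + 1),
      Nat.add_sub_cancel, hSzstep, hSstep, hhstep n hn]
    simp only [φ, one_mul]
    push_cast
    linear_combination (-(g z (n + 1) * h z (n + 1) *
      (Complex.exp (X (n + 1) ω - X n ω) - 1))) * hpow
  have hL0 : ∀ ω, L 0 ω = 0 := fun ω => by simp [hL]
  have hL𝓕 : ∀ n ≤ N, StronglyMeasurable[𝓕 n] (L n) := by
    intro n
    induction n with
    | zero =>
      intro _
      rw [show L 0 = fun _ => 0 from funext hL0]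
      exact stronglyMeasurable_const
    | succ n ih =>
      intro hn
      rw [show L (n + 1) = _ from funext (hLstep n hn)]
      have hle := 𝓕.mono n.le_succ
      have hd : Measurable[𝓕 (n + 1)] fun ω => X (n + 1) ω - X n ω :=
        (hXm𝓕 (n + 1)).sub ((hXm𝓕 n).mono hle le_rfl)
      exact ((ih (by omega)).mono hle).add
        ((((hSz𝓕 n).mono hle).const_mul _).mul ((hφm n).comp hd).stronglyMeasurable)
  have hL2 : ∀ n ≤ N, MemLp (L n) 2 P := by
    intro n
    induction n with
    | zero =>
      intro _
      rw [show L 0 = fun _ => 0 from funext hL0]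
      exact memLp_const 0
    | succ n ih =>
      intro hn
      rw [show L (n + 1) = _ from funext (hLstep n hn)]
      exact (ih (by omega)).add (memLp_two_mul_of_indep_comap (𝓕.le n) (hdm n) (hsucc n hn)
        ((hSz𝓕 n).const_mul _) (hφm n) ((hSz2 n (by omega)).const_mul _) (hφ2 n hn))
  -- the martingale part of the price
  have hMstep : ∀ n < N, ∀ᵐ ω ∂P, (M (n + 1) ω : ℂ) =
      M n ω + S n ω * ψ n (X (n + 1) ω - X n ω) := by
    intro n hn
    have hexpi : Integrable (fun ω => Real.exp (X (n + 1) ω - X n ω)) P := by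
      refine ((hE1 n hn).integrable one_le_two).re.congr (.of_forall fun ω => ?_)
      simp [Complex.exp_re]
    have hm1 : m 1 (n + 1) = ((∫ ω, Real.exp (X (n + 1) ω - X n ω) ∂P : ℝ) : ℂ) := by
      rw [hm', ← integral_complex_ofReal]
      simp
    have hce := condExp_mul_of_indep_comap (φ := fun x => Real.exp x - 1) (𝓕.le n) (hdm n)
      (hsucc n hn) (hS𝓕 n) (by fun_prop) ((hS2 n hn.le).integrable one_le_two)
      (hexpi.sub (integrable_const 1))
    rw [integral_sub hexpi (integrable_const 1)] at hce
    filter_upwards [hce] with ω hω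
    have hdiff : (fun ω' => S (n + 1) ω' - S n ω') =
        fun ω' => S n ω' * (Real.exp (X (n + 1) ω' - X n ω') - 1) := by
      ext ω'
      rw [hSstep]
      ring
    rw [hM, hM, Finset.sum_Icc_succ_top (by omega), Nat.add_sub_cancel, hdiff, hω, hSstep]
    simp only [ψ, hm1, integral_const, probReal_univ, one_smul, one_mul]
    push_cast
    ring
  have hM𝓕 : ∀ n, StronglyMeasurable[𝓕 n] fun ω => (M n ω : ℂ) := by
    intro n
    refine Complex.continuous_ofReal.comp_stronglyMeasurable ?_
    rw [show M n = _ from funext (hM n)]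
    refine (hS𝓕 n).sub (Finset.stronglyMeasurable_fun_sum _ fun k hk => ?_)
    exact stronglyMeasurable_condExp.mono
      (𝓕.mono ((Nat.sub_le k 1).trans (Finset.mem_Icc.1 hk).2))
  have hM2 : ∀ n ≤ N, MemLp (fun ω => (M n ω : ℂ)) 2 P := by
    intro n
    induction n with
    | zero =>
      intro _
      simpa [hM] using hSC2 0 (Nat.zero_le N)
    | succ n ih =>
      intro hn
      refine ((ih (by omega)).add (memLp_two_mul_of_indep_comap (𝓕.le n) (hdm n) (hsucc n hn)
        (Complex.continuous_ofReal.comp_stronglyMeasurable (hS𝓕 n)) (hψm n)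
        (hSC2 n (by omega)) (hψ2 n hn))).ae_eq ?_
      filter_upwards [hMstep n hn] with ω hω
      exact hω.symm
  refine ⟨fun ω => ?_, hL2, hL0, hL𝓕, fun i j hij hj => ?_, fun i j hij hj => ?_,
    fun n _ ω => ?_⟩
  · rw [hHz, hh, Finset.Icc_eq_empty (by omega), Finset.prod_empty, one_mul]
  · refine condExp_ae_eq_of_forall_succ hL𝓕 (fun n hn => (hL2 n hn).integrable one_le_two)
      (fun n hn => ?_) hij hj
    rw [show L (n + 1) = _ from funext (hLstep n hn)]
    exact condExp_add_mul_of_indep_comap (𝓕.le n) (hdm n) (hsucc n hn) (hL𝓕 n hn.le)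
      ((hL2 n hn.le).integrable one_le_two) ((hSz𝓕 n).const_mul _) (hφm n)
      (((hSz2 n hn.le).const_mul _).integrable one_le_two)
      ((hφ2 n hn).integrable one_le_two) (hφ0 n hn)
  · refine condExp_ae_eq_of_forall_succ (Q := fun n ω => L n ω * (M n ω : ℂ))
      (fun n hn => (hL𝓕 n hn).mul (hM𝓕 n)) (fun n hn => (hL2 n hn).integrable_mul (hM2 n hn))
      (fun n hn => ?_) hij hj
    refine (condExp_congr_ae ?_).trans
      (condExp_mul_add_mul_of_indep_comap (𝓕.le n) (hdm n) (hsucc n hn)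
        (hL𝓕 n hn.le) (hM𝓕 n) ((hSz𝓕 n).const_mul (h z (n + 1)))
        (Complex.continuous_ofReal.comp_stronglyMeasurable (hS𝓕 n)) (hφm n) (hψm n)
        (hL2 n hn.le) (hM2 n hn.le) ((hSz2 n hn.le).const_mul _) (hSC2 n hn.le)
        (hφ2 n hn) (hψ2 n hn) (hφ0 n hn) (hψ0 n hn) (hφψ n hn))
    filter_upwards [hMstep n hn] with ω hω
    rw [hω, hLstep n hn]
  · rw [hL]
    ring
end

section
/- Discrete FS decomposition of Laplace-type contingent claims: under Assumptions A and B, the claim H = f(S_N) with f(s) = ∫_ℂ s^z Π(dz) admits the real discrete Föllmer–Schweizer decomposition H = H_0 + Σ_{k=1}^N ξ^H_k ΔS_k + L^H_N, where for every n, H_n = ∫_ℂ H(z)_n Π(dz), ξ^H_n = ∫_ℂ ξ(z)_n Π(dz), and L^H_n = ∫_ℂ L(z)_n Π(dz) = H_n − H_0 − Σ_{k=1}^n ξ^H_k ΔS_k; moreover the processes (H_n), (ξ^H_n) and (L^H_n) are real-valued, L^H is a square-integrable martingale with E[L^H_0] = 0, and L^H · M is a martingale. -/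
open MeasureTheory ProbabilityTheory

/-! ### Conditional expectations of functions of an independent variable -/

section Freezing

variable {Ω E F : Type*} {𝓖 m0 : MeasurableSpace Ω} {P : Measure Ω}

lemma indepFun_of_indep_comap [MeasurableSpace E] [MeasurableSpace F] {W : Ω → E}
    (hW : Measurable[𝓖] W) {Z : Ω → F}
    (hind : Indep 𝓖 (MeasurableSpace.comap Z inferInstance) P) : IndepFun W Z P :=
  (IndepFun_iff_Indep W Z P).2 (indep_of_indep_of_le_left hind hW.comap_le)

/-- Freezing lemma: if `W` is `𝓖`-measurable, `Z` is independent of `𝓖` and `Ψ (w, Z)` is centred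
for every `w`, then `Ψ (W, Z)` has vanishing conditional expectation given `𝓖`. -/
lemma condExp_eq_zero_of_indep [IsProbabilityMeasure P] [MeasurableSpace E]
    [NormedAddCommGroup F] [NormedSpace ℝ F] [CompleteSpace F] (h𝓖 : 𝓖 ≤ m0)
    {W : Ω → E} (hW : Measurable[𝓖] W) {Z : Ω → ℝ}
    (hZ : Measurable Z) (hind : Indep 𝓖 (MeasurableSpace.comap Z inferInstance) P)
    {Ψ : E × ℝ → F} (hΨ : StronglyMeasurable Ψ)
    (hf_int : Integrable (fun ω => Ψ (W ω, Z ω)) P)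
    (hzero : ∀ w, ∫ ω, Ψ (w, Z ω) ∂P = 0) :
    P[fun ω => Ψ (W ω, Z ω) | 𝓖] =ᵐ[P] 0 := by
  refine (ae_eq_condExp_of_forall_setIntegral_eq h𝓖 hf_int
    (fun s _ _ => (integrable_zero Ω F P).integrableOn) (fun s hs _ => ?_)
    aestronglyMeasurable_zero).symm
  have hW' : Measurable[𝓖] fun ω => (W ω, s.indicator (fun _ => (1 : ℝ)) ω) :=
    hW.prodMk (measurable_const.indicator hs)
  have hmap := (indepFun_iff_map_prod_eq_prod_map_map (hW'.mono h𝓖 le_rfl).aemeasurable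
    hZ.aemeasurable).1 (indepFun_of_indep_comap hW' hind)
  have hpair : Measurable fun ω => ((W ω, s.indicator (fun _ => (1 : ℝ)) ω), Z ω) :=
    (hW'.mono h𝓖 le_rfl).prodMk hZ
  have hΦ : StronglyMeasurable fun q : (E × ℝ) × ℝ => q.1.2 • Ψ (q.1.1, q.2) :=
    (measurable_snd.comp measurable_fst).stronglyMeasurable.smul
      (hΨ.comp_measurable ((measurable_fst.comp measurable_fst).prodMk measurable_snd))
  have hind_eq : (fun ω => s.indicator (fun _ => (1 : ℝ)) ω • Ψ (W ω, Z ω))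
      = s.indicator fun ω => Ψ (W ω, Z ω) := by
    ext ω
    by_cases hω : ω ∈ s <;> simp [hω]
  have hΦint : Integrable (fun q : (E × ℝ) × ℝ => q.1.2 • Ψ (q.1.1, q.2))
      (P.map fun ω => ((W ω, s.indicator (fun _ => (1 : ℝ)) ω), Z ω)) := by
    rw [integrable_map_measure hΦ.aestronglyMeasurable hpair.aemeasurable]
    change Integrable (fun ω => s.indicator (fun _ => (1 : ℝ)) ω • Ψ (W ω, Z ω)) P
    rw [hind_eq]
    exact hf_int.indicator (h𝓖 s hs)
  have hset : ∫ ω in s, Ψ (W ω, Z ω) ∂P = 0 := by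
    rw [← integral_indicator (h𝓖 s hs), ← hind_eq,
      ← integral_map (f := fun q : (E × ℝ) × ℝ => q.1.2 • Ψ (q.1.1, q.2)) hpair.aemeasurable
        hΦ.aestronglyMeasurable]
    rw [hmap] at hΦint ⊢
    rw [integral_prod _ hΦint]
    refine integral_eq_zero_of_ae (ae_of_all _ fun q => ?_)
    have hq : StronglyMeasurable fun z : ℝ => Ψ (q.1, z) :=
      hΨ.comp_measurable (measurable_const.prodMk measurable_id)
    simp [integral_smul, integral_map hZ.aemeasurable hq.aestronglyMeasurable, hzero]
  simp [hset]

/-- An adapted integrable process whose increments have vanishing conditional expectation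
satisfies the martingale property. -/
lemma condExp_eq_of_condExp_increment_eq_zero [IsProbabilityMeasure P]
    [NormedAddCommGroup F] [NormedSpace ℝ F] [CompleteSpace F]
    {𝓕 : Filtration ℕ m0} {N : ℕ} {Z : ℕ → Ω → F}
    (hmeas : ∀ n, n ≤ N → StronglyMeasurable[𝓕 n] (Z n))
    (hf_int : ∀ n, n ≤ N → Integrable (Z n) P)
    (hincr : ∀ n, n < N → P[fun ω => Z (n + 1) ω - Z n ω | 𝓕 n] =ᵐ[P] 0)
    {i j : ℕ} (hij : i ≤ j) (hj : j ≤ N) : P[Z j | 𝓕 i] =ᵐ[P] Z i := by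
  induction j, hij using Nat.le_induction with
  | base => rw [condExp_of_stronglyMeasurable (𝓕.le i) (hmeas i hj) (hf_int i hj)]
  | succ j hij ih =>
    have hstep : P[Z (j + 1) | 𝓕 j] =ᵐ[P] Z j := by
      have hsub := condExp_sub (hf_int (j + 1) hj) (hf_int j (by omega)) (𝓕 j)
      rw [condExp_of_stronglyMeasurable (𝓕.le j) (hmeas j (by omega)) (hf_int j (by omega))] at hsub
      filter_upwards [hsub, hincr j (by omega)] with ω h1 h2
      have h3 : P[Z (j + 1) - Z j | 𝓕 j] ω = 0 := h2
      rw [h3] at h1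
      exact (sub_eq_zero.1 h1.symm)
    calc P[Z (j + 1) | 𝓕 i] =ᵐ[P] P[P[Z (j + 1) | 𝓕 j] | 𝓕 i] :=
          (condExp_condExp_of_le (𝓕.mono hij) (𝓕.le j)).symm
      _ =ᵐ[P] P[Z j | 𝓕 i] := condExp_congr_ae hstep
      _ =ᵐ[P] Z i := ih (by omega)

/-- The product of two independent square-integrable variables is square-integrable. -/
lemma ProbabilityTheory.IndepFun.memLp_two_mul {U V : Ω → ℝ} (hUV : IndepFun U V P)
    (hU : MemLp U 2 P) (hV : MemLp V 2 P) : MemLp (fun ω => U ω * V ω) 2 P := by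
  refine (memLp_two_iff_integrable_sq
    (hU.aestronglyMeasurable.mul hV.aestronglyMeasurable)).2 ?_
  have := (hUV.comp (measurable_id.pow_const 2) (measurable_id.pow_const 2)).integrable_mul
    hU.integrable_sq hV.integrable_sq
  refine this.congr (ae_of_all _ fun ω => ?_)
  simp [mul_pow]

end Freezing

/-! ### Exponential transforms of complex measures -/

section ExpTransform

variable {Ω : Type*} {m0 : MeasurableSpace Ω} {P : Measure Ω} [IsProbabilityMeasure P]
  {μ : Measure ℂ} {k : ℂ → ℂ} {a b : ℝ}

/-- The bilateral exponential transform `y ↦ ∫ e^{vy} k(v) μ(dv)`. -/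
noncomputable def expTransform (μ : Measure ℂ) (k : ℂ → ℂ) (y : ℝ) : ℂ :=
  ∫ v, k v * Complex.exp (v * y) ∂μ

lemma norm_cexp_mul_ofReal_le {v : ℂ} (hv : a ≤ v.re ∧ v.re ≤ b) (y : ℝ) :
    ‖Complex.exp (v * y)‖ ≤ Real.exp (a * y) + Real.exp (b * y) := by
  rw [Complex.norm_exp, Complex.re_mul_ofReal]
  rcases le_total 0 y with hy | hy
  · have := Real.exp_le_exp.2 (mul_le_mul_of_nonneg_right hv.2 hy)
    linarith [Real.exp_pos (a * y)]
  · have := Real.exp_le_exp.2 (mul_le_mul_of_nonpos_right hv.1 hy)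
    linarith [Real.exp_pos (b * y)]

lemma integrable_mul_cexp (hk : Integrable k μ) (hre : ∀ᵐ v ∂μ, a ≤ v.re ∧ v.re ≤ b) (y : ℝ) :
    Integrable (fun v => k v * Complex.exp (v * y)) μ := by
  refine hk.mul_bdd (c := Real.exp (a * y) + Real.exp (b * y)) ?_ ?_
  · exact (by fun_prop : Continuous fun v : ℂ => Complex.exp (v * y)).aestronglyMeasurable
  · filter_upwards [hre] with v hv using norm_cexp_mul_ofReal_le hv y

lemma norm_expTransform_le (hk : Integrable k μ) (hre : ∀ᵐ v ∂μ, a ≤ v.re ∧ v.re ≤ b) (y : ℝ) :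
    ‖expTransform μ k y‖ ≤ (∫ v, ‖k v‖ ∂μ) * (Real.exp (a * y) + Real.exp (b * y)) := by
  rw [expTransform, ← integral_mul_const]
  refine norm_integral_le_of_norm_le (hk.norm.mul_const _) ?_
  filter_upwards [hre] with v hv
  rw [norm_mul]
  exact mul_le_mul_of_nonneg_left (norm_cexp_mul_ofReal_le hv y) (norm_nonneg _)

lemma stronglyMeasurable_expTransform [SFinite μ] (hk : AEStronglyMeasurable k μ) :
    StronglyMeasurable (expTransform μ k) := by
  have heq : expTransform μ k = fun y : ℝ => ∫ v, hk.mk k v * Complex.exp (v * y) ∂μ := by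
    ext y
    refine integral_congr_ae ?_
    filter_upwards [hk.ae_eq_mk] with v hv
    rw [hv]
  rw [heq]
  refine StronglyMeasurable.integral_prod_right ?_
  refine (hk.stronglyMeasurable_mk.comp_measurable measurable_snd).mul ?_
  exact (by fun_prop : Continuous fun q : ℝ × ℂ => Complex.exp (q.2 * q.1)).stronglyMeasurable

lemma expTransform_congr {k' : ℂ → ℂ} (h : k =ᵐ[μ] k') (y : ℝ) :
    expTransform μ k y = expTransform μ k' y := by
  refine integral_congr_ae ?_
  filter_upwards [h] with v hv
  rw [hv]

/-- Averaging the exponential transform over a random shift, with a real weight. -/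
lemma integral_expTransform_add_mul [SFinite μ] (hk : Integrable k μ)
    (hre : ∀ᵐ v ∂μ, a ≤ v.re ∧ v.re ≤ b) {Z θ : Ω → ℝ} (hZ : Measurable Z)
    (hθ : Measurable θ) (ha : Integrable (fun ω => Real.exp (a * Z ω) * θ ω) P)
    (hb : Integrable (fun ω => Real.exp (b * Z ω) * θ ω) P) (y : ℝ) :
    ∫ ω, expTransform μ k (y + Z ω) * (θ ω : ℂ) ∂P
      = expTransform μ (fun v => k v * ∫ ω, Complex.exp (v * Z ω) * (θ ω : ℂ) ∂P) y := by
  have hf_int : Integrable (Function.uncurry fun (ω : Ω) (v : ℂ) =>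
      k v * Complex.exp (v * ((y + Z ω : ℝ) : ℂ)) * (θ ω : ℂ)) (P.prod μ) := by
    have hdom : Integrable (fun q : Ω × ℂ =>
        (Real.exp (a * y) * ‖Real.exp (a * Z q.1) * θ q.1‖
          + Real.exp (b * y) * ‖Real.exp (b * Z q.1) * θ q.1‖) * ‖k q.2‖) (P.prod μ) :=
      ((ha.norm.const_mul _).add (hb.norm.const_mul _)).mul_prod hk.norm
    refine hdom.mono' ?_ ?_
    · refine (hk.aestronglyMeasurable.comp_snd.mul ?_).mul ?_
      · have : Measurable fun q : Ω × ℂ => Complex.exp (q.2 * ((y + Z q.1 : ℝ) : ℂ)) := by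
          fun_prop
        exact this.aestronglyMeasurable
      · have : Measurable fun q : Ω × ℂ => (θ q.1 : ℂ) := by fun_prop
        exact this.aestronglyMeasurable
    · filter_upwards [Measure.quasiMeasurePreserving_snd.ae hre] with q hq
      have h1 := norm_cexp_mul_ofReal_le hq (y + Z q.1)
      rw [mul_add, mul_add, Real.exp_add, Real.exp_add] at h1
      simp only [Function.uncurry, norm_mul, Real.norm_eq_abs, Real.abs_exp, Complex.norm_real]
      calc _ ≤ ‖k q.2‖ * (Real.exp (a * y) * Real.exp (a * Z q.1)
              + Real.exp (b * y) * Real.exp (b * Z q.1)) * |θ q.1| := by gcongr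
        _ = _ := by ring
  have hswap := integral_integral_swap hf_int
  calc ∫ ω, expTransform μ k (y + Z ω) * (θ ω : ℂ) ∂P
      = ∫ ω, ∫ v, k v * Complex.exp (v * ((y + Z ω : ℝ) : ℂ)) * (θ ω : ℂ) ∂μ ∂P := by
        simp only [integral_mul_const, expTransform]
    _ = _ := hswap
    _ = _ := by
        refine integral_congr_ae (ae_of_all _ fun v => ?_)
        simp only
        rw [mul_right_comm, ← integral_const_mul]
        refine integral_congr_ae (ae_of_all _ fun ω => ?_)
        simp only [Complex.ofReal_add, mul_add, Complex.exp_add]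
        ring

lemma integral_expTransform_add [SFinite μ] (hk : Integrable k μ)
    (hre : ∀ᵐ v ∂μ, a ≤ v.re ∧ v.re ≤ b) {Z : Ω → ℝ} (hZ : Measurable Z)
    (ha : Integrable (fun ω => Real.exp (a * Z ω)) P)
    (hb : Integrable (fun ω => Real.exp (b * Z ω)) P) (y : ℝ) :
    ∫ ω, expTransform μ k (y + Z ω) ∂P
      = expTransform μ (fun v => k v * ∫ ω, Complex.exp (v * Z ω) ∂P) y := by
  simpa using integral_expTransform_add_mul (θ := fun _ => 1) hk hre hZ measurable_const
    (by simpa using ha) (by simpa using hb) y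

end ExpTransform

/-! ### Föllmer–Schweizer residuals along a process with independent increments -/

section Residual

variable {Ω : Type*} {m0 : MeasurableSpace Ω} {P : Measure Ω}
  {𝓕 : Filtration ℕ m0} {N : ℕ} {Y : ℕ → Ω → ℝ} {A G : ℕ → ℝ → ℂ}

/-- The one-step hedging error as a function of the current log-price and its next increment. -/
noncomputable def hedgingError (A G : ℕ → ℝ → ℂ) (n : ℕ) (y δ : ℝ) : ℂ :=
  A (n + 1) (y + δ) - A n y - G (n + 1) y * (Real.exp δ - 1 : ℝ)

/-- The cumulative hedging error of the value functions `A` and hedging amounts `G`. -/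
noncomputable def hedgingResidual (A G : ℕ → ℝ → ℂ) (Y : ℕ → Ω → ℝ) (n : ℕ) (ω : Ω) : ℂ :=
  A n (Y n ω) - A 0 (Y 0 ω) -
    ∑ k ∈ Finset.Icc 1 n, G k (Y (k - 1) ω) * (Real.exp (Y k ω - Y (k - 1) ω) - 1 : ℝ)

/-- Value functions `A` and hedging amounts `G` along an adapted log-price `Y` with independent
increments, such that the one-step hedging errors are centred and orthogonal to the price. -/
structure IsOrthogonalHedge (P : Measure Ω) (𝓕 : Filtration ℕ m0) (N : ℕ) (Y : ℕ → Ω → ℝ)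
    (A G : ℕ → ℝ → ℂ) : Prop where
  adapted : StronglyAdapted 𝓕 Y
  indep : ∀ n, n < N →
    Indep (𝓕 n) (MeasurableSpace.comap (fun ω => Y (n + 1) ω - Y n ω) inferInstance) P
  memLp_price : ∀ n, n ≤ N → MemLp (fun ω => Real.exp (Y n ω)) 2 P
  memLp_return : ∀ n, n < N → MemLp (fun ω => Real.exp (Y (n + 1) ω - Y n ω)) 2 P
  measurable_value : ∀ n, n ≤ N → StronglyMeasurable (A n)
  measurable_hedge : ∀ n, n < N → StronglyMeasurable (G (n + 1))
  memLp_value : ∀ n, n ≤ N → MemLp (fun ω => A n (Y n ω)) 2 P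
  memLp_hedge : ∀ n, n < N → MemLp (fun ω => G (n + 1) (Y n ω)) 2 P
  memLp_shift : ∀ n, n < N → ∀ y, MemLp (fun ω => A (n + 1) (y + (Y (n + 1) ω - Y n ω))) 2 P
  centred : ∀ n, n < N → ∀ y, ∫ ω, hedgingError A G n y (Y (n + 1) ω - Y n ω) ∂P = 0
  orthogonal : ∀ n, n < N → ∀ y, ∫ ω, hedgingError A G n y (Y (n + 1) ω - Y n ω) *
    (Real.exp (Y (n + 1) ω - Y n ω) : ℂ) ∂P = 0

lemma hedgingResidual_succ_sub (A G : ℕ → ℝ → ℂ) (Y : ℕ → Ω → ℝ) (n : ℕ) (ω : Ω) :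
    hedgingResidual A G Y (n + 1) ω - hedgingResidual A G Y n ω
      = hedgingError A G n (Y n ω) (Y (n + 1) ω - Y n ω) := by
  rw [hedgingResidual, hedgingResidual, hedgingError, Finset.sum_Icc_succ_top (by omega)]
  simp only [Nat.add_sub_cancel, add_sub_cancel]
  ring

namespace IsOrthogonalHedge

lemma measurable (h : IsOrthogonalHedge P 𝓕 N Y A G) (n : ℕ) : Measurable (Y n) :=
  ((h.adapted n).measurable).mono (𝓕.le n) le_rfl

lemma measurable_increment (h : IsOrthogonalHedge P 𝓕 N Y A G) (n : ℕ) :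
    Measurable fun ω => Y (n + 1) ω - Y n ω :=
  (h.measurable (n + 1)).sub (h.measurable n)

lemma stronglyMeasurable_hedgingError (h : IsOrthogonalHedge P 𝓕 N Y A G) {n : ℕ} (hn : n < N) :
    StronglyMeasurable fun q : ℝ × ℝ => hedgingError A G n q.1 q.2 := by
  refine (((h.measurable_value (n + 1) hn).comp_measurable
    (measurable_fst.add measurable_snd)).sub
      ((h.measurable_value n hn.le).comp_measurable measurable_fst)).sub
        (((h.measurable_hedge n hn).comp_measurable measurable_fst).mul ?_)
  exact (by fun_prop : Measurable fun q : ℝ × ℝ =>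
    ((Real.exp q.2 - 1 : ℝ) : ℂ)).stronglyMeasurable

lemma memLp_hedgingError [IsProbabilityMeasure P]
    (h : IsOrthogonalHedge P 𝓕 N Y A G) {n : ℕ} (hn : n < N) (y : ℝ) :
    MemLp (fun ω => hedgingError A G n y (Y (n + 1) ω - Y n ω)) 2 P :=
  ((h.memLp_shift n hn y).sub (memLp_const _)).sub
    ((((h.memLp_return n hn).sub (memLp_const 1)).ofReal).const_mul (G (n + 1) y))

lemma stronglyMeasurable_residual (h : IsOrthogonalHedge P 𝓕 N Y A G) {n : ℕ} (hn : n ≤ N) :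
    StronglyMeasurable[𝓕 n] (hedgingResidual A G Y n) := by
  have hY : ∀ k, k ≤ n → Measurable[𝓕 n] (Y k) := fun k hk =>
    (h.adapted k).measurable.mono (𝓕.mono hk) le_rfl
  refine ((((h.measurable_value n hn).comp_measurable (hY n le_rfl)).sub
    ((h.measurable_value 0 (Nat.zero_le _)).comp_measurable (hY 0 (Nat.zero_le _)))).sub ?_)
  refine Finset.stronglyMeasurable_fun_sum _ fun k hk => ?_
  obtain ⟨k, rfl⟩ : ∃ l, k = l + 1 := ⟨k - 1, by have := (Finset.mem_Icc.1 hk).1; omega⟩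
  have hk' := (Finset.mem_Icc.1 hk).2
  simp only [Nat.add_sub_cancel]
  refine ((h.measurable_hedge k (by omega)).comp_measurable (hY k (by omega))).mul ?_
  have : Measurable[𝓕 n] fun ω => Y (k + 1) ω - Y k ω := (hY _ hk').sub (hY _ (by omega))
  exact (Complex.measurable_ofReal.comp
    ((Real.measurable_exp.comp this).sub_const 1)).stronglyMeasurable

lemma memLp_residual [IsProbabilityMeasure P]
    (h : IsOrthogonalHedge P 𝓕 N Y A G) {n : ℕ} (hn : n ≤ N) :
    MemLp (hedgingResidual A G Y n) 2 P := by
  refine ((h.memLp_value n hn).sub (h.memLp_value 0 (Nat.zero_le _))).sub ?_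
  refine memLp_finsetSum _ fun k hk => ?_
  obtain ⟨k, rfl⟩ : ∃ l, k = l + 1 := ⟨k - 1, by have := (Finset.mem_Icc.1 hk).1; omega⟩
  have hk' : k < N := by have := (Finset.mem_Icc.1 hk).2; omega
  simp only [Nat.add_sub_cancel]
  have hind : IndepFun (fun ω => ‖G (k + 1) (Y k ω)‖)
      (fun ω => Real.exp (Y (k + 1) ω - Y k ω) - 1) P :=
    (indepFun_of_indep_comap (h.adapted k).measurable (h.indep k hk')).comp
      (h.measurable_hedge k hk').norm.measurable (Real.measurable_exp.sub_const 1)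
  refine (hind.memLp_two_mul (h.memLp_hedge k hk').norm
    ((h.memLp_return k hk').sub (memLp_const 1))).of_le
    ((h.memLp_hedge k hk').aestronglyMeasurable.mul
      ((h.memLp_return k hk').sub (memLp_const 1)).ofReal.aestronglyMeasurable)
    (ae_of_all _ fun ω => ?_)
  rw [norm_mul, norm_mul, norm_norm, Complex.norm_real]

lemma condExp_residual [IsProbabilityMeasure P]
    (h : IsOrthogonalHedge P 𝓕 N Y A G) {i j : ℕ} (hij : i ≤ j)
    (hj : j ≤ N) :
    P[hedgingResidual A G Y j | 𝓕 i] =ᵐ[P] hedgingResidual A G Y i := by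
  refine condExp_eq_of_condExp_increment_eq_zero (N := N)
    (fun n hn => h.stronglyMeasurable_residual hn)
    (fun n hn => (h.memLp_residual hn).integrable one_le_two) (fun n hn => ?_) hij hj
  have hf_int := ((h.memLp_residual (n := n + 1) hn).sub
    (h.memLp_residual hn.le)).integrable one_le_two
  simp only [Pi.sub_def, hedgingResidual_succ_sub] at hf_int ⊢
  exact condExp_eq_zero_of_indep (𝓕.le n) (h.adapted n).measurable
    (h.measurable_increment n) (h.indep n hn) (h.stronglyMeasurable_hedgingError hn) hf_int
    (h.centred n hn)

/-- The conditional expectation of a price increment. -/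
lemma condExp_price_increment [IsProbabilityMeasure P]
    (h : IsOrthogonalHedge P 𝓕 N Y A G) {n : ℕ} (hn : n < N) :
    P[fun ω => Real.exp (Y (n + 1) ω) - Real.exp (Y n ω) | 𝓕 n] =ᵐ[P]
      fun ω => Real.exp (Y n ω) * ((∫ ω', Real.exp (Y (n + 1) ω' - Y n ω') ∂P) - 1) := by
  set r := ∫ ω', Real.exp (Y (n + 1) ω' - Y n ω') ∂P with hr
  have hexp : ∀ ω, Real.exp (Y (n + 1) ω) = Real.exp (Y n ω) * Real.exp (Y (n + 1) ω - Y n ω) :=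
    fun ω => by rw [← Real.exp_add]; congr 1; ring
  have hint0 : Integrable (fun ω => Real.exp (Y n ω)) P :=
    (h.memLp_price n hn.le).integrable one_le_two
  have hint1 : Integrable (fun ω => Real.exp (Y (n + 1) ω)) P :=
    (h.memLp_price (n + 1) hn).integrable one_le_two
  have hf_intΔ : Integrable (fun ω => Real.exp (Y (n + 1) ω - Y n ω)) P :=
    (h.memLp_return n hn).integrable one_le_two
  have hzero : P[fun ω => Real.exp (Y n ω) * (Real.exp (Y (n + 1) ω - Y n ω) - r) | 𝓕 n]
      =ᵐ[P] 0 := by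
    refine condExp_eq_zero_of_indep (Ψ := fun q : ℝ × ℝ => Real.exp q.1 * (Real.exp q.2 - r))
      (𝓕.le n) (h.adapted n).measurable (h.measurable_increment n) (h.indep n hn)
      (by fun_prop : Measurable _).stronglyMeasurable ?_ fun y => ?_
    · refine (hint1.sub (hint0.mul_const r)).congr (ae_of_all _ fun ω => ?_)
      simp only [Pi.sub_apply, hexp ω]
      ring
    · simp only
      rw [integral_const_mul, integral_sub hf_intΔ (integrable_const _)]
      simp [hr]
  have hmeas : StronglyMeasurable[𝓕 n] fun ω => Real.exp (Y n ω) * (r - 1) :=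
    ((Real.measurable_exp.comp (h.adapted n).measurable).mul_const _).stronglyMeasurable
  have hsub := condExp_sub (hint1.sub hint0) (hint0.mul_const (r - 1)) (𝓕 n)
  rw [condExp_of_stronglyMeasurable (𝓕.le n) hmeas (hint0.mul_const _)] at hsub
  have heq : (((fun ω => Real.exp (Y (n + 1) ω)) - fun ω => Real.exp (Y n ω))
      - fun ω => Real.exp (Y n ω) * (r - 1))
      = fun ω => Real.exp (Y n ω) * (Real.exp (Y (n + 1) ω - Y n ω) - r) := by
    ext ω
    simp only [Pi.sub_apply, hexp ω]
    ring
  rw [heq] at hsub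
  filter_upwards [hsub, hzero] with ω h1 h2
  rw [h2] at h1
  exact sub_eq_zero.1 h1.symm

variable {S M : ℕ → Ω → ℝ}

lemma doobMartingale_succ_sub [IsProbabilityMeasure P]
    (h : IsOrthogonalHedge P 𝓕 N Y A G)
    (hS : ∀ n ω, S n ω = Real.exp (Y n ω))
    (hM : ∀ n ω, M n ω = S n ω - ∑ k ∈ Finset.Icc 1 n,
      condExp (𝓕 (k - 1)) P (fun ω' => S k ω' - S (k - 1) ω') ω) {n : ℕ} (hn : n < N) :
    ∀ᵐ ω ∂P, M (n + 1) ω - M n ω = Real.exp (Y n ω) *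
      (Real.exp (Y (n + 1) ω - Y n ω) - ∫ ω', Real.exp (Y (n + 1) ω' - Y n ω') ∂P) := by
  filter_upwards [h.condExp_price_increment hn] with ω hω
  rw [hM, hM, Finset.sum_Icc_succ_top (by omega)]
  simp only [Nat.add_sub_cancel, hS] at hω ⊢
  rw [hω]
  have hexp : Real.exp (Y (n + 1) ω) = Real.exp (Y n ω) * Real.exp (Y (n + 1) ω - Y n ω) := by
    rw [← Real.exp_add]; congr 1; ring
  rw [hexp]
  ring

lemma memLp_doobMartingale [IsProbabilityMeasure P]
    (h : IsOrthogonalHedge P 𝓕 N Y A G)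
    (hS : ∀ n ω, S n ω = Real.exp (Y n ω))
    (hM : ∀ n ω, M n ω = S n ω - ∑ k ∈ Finset.Icc 1 n,
      condExp (𝓕 (k - 1)) P (fun ω' => S k ω' - S (k - 1) ω') ω) {n : ℕ} (hn : n ≤ N) :
    MemLp (M n) 2 P := by
  induction n with
  | zero =>
    refine (h.memLp_price 0 hn).ae_eq (ae_of_all _ fun ω => ?_)
    simp [hM, hS]
  | succ n ih =>
    refine ((ih (by omega)).add ((h.memLp_price (n + 1) hn).sub
      ((h.memLp_price n (by omega)).mul_const
        (∫ ω', Real.exp (Y (n + 1) ω' - Y n ω') ∂P)))).ae_eq ?_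
    filter_upwards [h.doobMartingale_succ_sub hS hM hn] with ω hω
    have hexp : Real.exp (Y (n + 1) ω) = Real.exp (Y n ω) * Real.exp (Y (n + 1) ω - Y n ω) := by
      rw [← Real.exp_add]; congr 1; ring
    simp only [Pi.add_apply, Pi.sub_apply, hexp]
    linarith

lemma stronglyMeasurable_doobMartingale (h : IsOrthogonalHedge P 𝓕 N Y A G)
    (hS : ∀ n ω, S n ω = Real.exp (Y n ω))
    (hM : ∀ n ω, M n ω = S n ω - ∑ k ∈ Finset.Icc 1 n,
      condExp (𝓕 (k - 1)) P (fun ω' => S k ω' - S (k - 1) ω') ω) (n : ℕ) :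
    StronglyMeasurable[𝓕 n] (M n) := by
  have hMn : M n = fun ω => Real.exp (Y n ω) - ∑ k ∈ Finset.Icc 1 n,
      condExp (𝓕 (k - 1)) P (fun ω' => S k ω' - S (k - 1) ω') ω := by
    ext ω
    rw [hM, hS]
  rw [hMn]
  refine (Real.measurable_exp.comp (h.adapted n).measurable).stronglyMeasurable.sub
    (Finset.stronglyMeasurable_fun_sum _ fun k hk => ?_)
  exact stronglyMeasurable_condExp.mono (𝓕.mono (by have := (Finset.mem_Icc.1 hk).2; omega))

/-- The residual is strongly orthogonal to the martingale part of the price. -/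
lemma condExp_residual_mul_doobMartingale [IsProbabilityMeasure P]
    (h : IsOrthogonalHedge P 𝓕 N Y A G)
    (hS : ∀ n ω, S n ω = Real.exp (Y n ω))
    (hM : ∀ n ω, M n ω = S n ω - ∑ k ∈ Finset.Icc 1 n,
      condExp (𝓕 (k - 1)) P (fun ω' => S k ω' - S (k - 1) ω') ω) {i j : ℕ} (hij : i ≤ j)
    (hj : j ≤ N) :
    P[fun ω => hedgingResidual A G Y j ω * (M j ω : ℂ) | 𝓕 i]
      =ᵐ[P] fun ω => hedgingResidual A G Y i ω * (M i ω : ℂ) := by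
  have hLM : ∀ n, n ≤ N → Integrable (fun ω => hedgingResidual A G Y n ω * (M n ω : ℂ)) P :=
    fun n hn => (h.memLp_residual hn).integrable_mul (h.memLp_doobMartingale hS hM hn).ofReal
  have hMmeas : ∀ n, Measurable[𝓕 n] fun ω => (M n ω : ℂ) := fun n =>
    Complex.measurable_ofReal.comp (h.stronglyMeasurable_doobMartingale hS hM n).measurable
  refine condExp_eq_of_condExp_increment_eq_zero (N := N)
    (Z := fun n ω => hedgingResidual A G Y n ω * (M n ω : ℂ))
    (fun n hn => (h.stronglyMeasurable_residual hn).mul (hMmeas n).stronglyMeasurable)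
    hLM (fun n hn => ?_) hij hj
  set r := ∫ ω', Real.exp (Y (n + 1) ω' - Y n ω') ∂P with hr
  let Ψ : ((ℂ × ℂ) × ℝ) × ℝ → ℂ := fun q =>
    q.1.1.1 * ((Real.exp q.1.2 * (Real.exp q.2 - r) : ℝ) : ℂ)
      + q.1.1.2 * hedgingError A G n q.1.2 q.2
      + hedgingError A G n q.1.2 q.2 * ((Real.exp q.1.2 * (Real.exp q.2 - r) : ℝ) : ℂ)
  have hE : Measurable fun q : ((ℂ × ℂ) × ℝ) × ℝ => hedgingError A G n q.1.2 q.2 :=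
    (h.stronglyMeasurable_hedgingError hn).measurable.comp
      ((measurable_snd.comp measurable_fst).prodMk measurable_snd)
  have hΨ : StronglyMeasurable Ψ := (by fun_prop : Measurable Ψ).stronglyMeasurable
  have hincr : (fun ω => hedgingResidual A G Y (n + 1) ω * (M (n + 1) ω : ℂ)
      - hedgingResidual A G Y n ω * (M n ω : ℂ)) =ᵐ[P]
      fun ω => Ψ (((hedgingResidual A G Y n ω, (M n ω : ℂ)), Y n ω), Y (n + 1) ω - Y n ω) := by
    filter_upwards [h.doobMartingale_succ_sub hS hM hn] with ω hω
    have h1 : hedgingResidual A G Y (n + 1) ω = hedgingResidual A G Y n ω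
        + hedgingError A G n (Y n ω) (Y (n + 1) ω - Y n ω) := by
      rw [← hedgingResidual_succ_sub]; ring
    have h2 : M (n + 1) ω = M n ω
        + Real.exp (Y n ω) * (Real.exp (Y (n + 1) ω - Y n ω) - r) := by linarith
    simp only [Ψ, h1, h2, Complex.ofReal_add]
    ring
  refine (condExp_congr_ae hincr).trans ?_
  refine condExp_eq_zero_of_indep (𝓕.le n)
    (((h.stronglyMeasurable_residual hn.le).measurable.prodMk (hMmeas n)).prodMk
      (h.adapted n).measurable) (h.measurable_increment n) (h.indep n hn) hΨ
    (((hLM (n + 1) hn).sub (hLM n hn.le)).congr hincr) ?_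
  rintro ⟨⟨l, c⟩, y⟩
  have hretLp : MemLp (fun ω => ((Real.exp (Y (n + 1) ω - Y n ω) : ℝ) : ℂ)) 2 P :=
    (h.memLp_return n hn).ofReal
  have hret : Integrable (fun ω => ((Real.exp (Y (n + 1) ω - Y n ω) : ℝ) : ℂ)) P :=
    hretLp.integrable one_le_two
  have herr := (h.memLp_hedgingError hn y).integrable one_le_two
  have hprod : Integrable (fun ω => hedgingError A G n y (Y (n + 1) ω - Y n ω) *
      ((Real.exp (Y (n + 1) ω - Y n ω) : ℝ) : ℂ)) P :=
    (h.memLp_hedgingError hn y).integrable_mul hretLp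
  have hΨy : (fun ω => Ψ (((l, c), y), Y (n + 1) ω - Y n ω)) = fun ω =>
      (l * (Real.exp y : ℂ)) * ((Real.exp (Y (n + 1) ω - Y n ω) : ℝ) : ℂ)
        - l * (Real.exp y : ℂ) * (r : ℂ)
      + (c - (Real.exp y : ℂ) * (r : ℂ)) * hedgingError A G n y (Y (n + 1) ω - Y n ω)
      + (Real.exp y : ℂ) * (hedgingError A G n y (Y (n + 1) ω - Y n ω) *
        ((Real.exp (Y (n + 1) ω - Y n ω) : ℝ) : ℂ)) := by
    ext ω
    simp only [Ψ, Complex.ofReal_mul, Complex.ofReal_sub]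
    ring
  have hprice : Integrable (fun ω =>
      (l * (Real.exp y : ℂ)) * ((Real.exp (Y (n + 1) ω - Y n ω) : ℝ) : ℂ)
        - l * (Real.exp y : ℂ) * (r : ℂ)) P := (hret.const_mul _).sub (integrable_const _)
  have hsum : Integrable (fun ω =>
      (l * (Real.exp y : ℂ)) * ((Real.exp (Y (n + 1) ω - Y n ω) : ℝ) : ℂ)
        - l * (Real.exp y : ℂ) * (r : ℂ)
      + (c - (Real.exp y : ℂ) * (r : ℂ)) * hedgingError A G n y (Y (n + 1) ω - Y n ω)) P :=
    hprice.add (herr.const_mul _)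
  rw [hΨy, integral_add hsum (hprod.const_mul _), integral_add hprice (herr.const_mul _),
    integral_sub (hret.const_mul _) (integrable_const _),
    integral_const_mul, integral_const_mul, integral_const_mul, integral_const_mul,
    h.centred n hn y, h.orthogonal n hn y, integral_complex_ofReal, ← hr]
  simp

end IsOrthogonalHedge

end Residual

/-! ### Exponential moments -/

section Moments

variable {Ω : Type*} {m0 : MeasurableSpace Ω} {P : Measure Ω}

lemma ProbabilityTheory.IndepFun.integrable_exp_of_add [IsProbabilityMeasure P]
    {U V : Ω → ℝ} (hUV : IndepFun U V P)
    (hU : Measurable U) (hV : Measurable V) {t : ℝ}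
    (hf_int : Integrable (fun ω => Real.exp (t * (U ω + V ω))) P) :
    Integrable (fun ω => Real.exp (t * U ω)) P ∧ Integrable (fun ω => Real.exp (t * V ω)) P := by
  have hexp : ∀ {W : Ω → ℝ}, ¬ (fun ω => Real.exp (t * W ω)) =ᵐ[P] 0 := fun h0 => by
    obtain ⟨ω, hω⟩ := h0.exists
    exact (Real.exp_pos _).ne' hω
  have hmeas : Measurable fun x : ℝ => Real.exp (t * x) := by fun_prop
  have hind : IndepFun (fun ω => Real.exp (t * U ω)) (fun ω => Real.exp (t * V ω)) P :=
    hUV.comp hmeas hmeas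
  have hmul : Integrable (fun ω => Real.exp (t * U ω) * Real.exp (t * V ω)) P := by
    simpa only [mul_add, Real.exp_add] using hf_int
  exact ⟨hind.integrable_left_of_integrable_op (fun x y => x * y) 1 one_ne_zero (by simp) hmul
      (hmeas.comp hU).aestronglyMeasurable (hmeas.comp hV).aestronglyMeasurable hexp,
    hind.integrable_right_of_integrable_op (fun x y => x * y) 1 one_ne_zero (by simp) hmul
      (hmeas.comp hU).aestronglyMeasurable (hmeas.comp hV).aestronglyMeasurable hexp⟩

/-- For an adapted process with independent increments, exponential moments of the terminal
value are inherited by all earlier values and by all increments. -/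
lemma integrable_exp_of_terminal [IsProbabilityMeasure P] {𝓕 : Filtration ℕ m0}
    {N : ℕ} {X : ℕ → Ω → ℝ}
    (hX : StronglyAdapted 𝓕 X)
    (hind : ∀ n, n < N →
      Indep (𝓕 n) (MeasurableSpace.comap (fun ω => X (n + 1) ω - X n ω) inferInstance) P)
    {t : ℝ} (hf_int : Integrable (fun ω => Real.exp (t * X N ω)) P) :
    (∀ n, n ≤ N → Integrable (fun ω => Real.exp (t * X n ω)) P) ∧
    (∀ n, n < N → Integrable (fun ω => Real.exp (t * (X (n + 1) ω - X n ω))) P) := by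
  have hmeas : ∀ n, Measurable (X n) := fun n => (hX n).measurable.mono (𝓕.le n) le_rfl
  have hstep : ∀ n, n < N → Integrable (fun ω => Real.exp (t * X (n + 1) ω)) P →
      Integrable (fun ω => Real.exp (t * X n ω)) P ∧
      Integrable (fun ω => Real.exp (t * (X (n + 1) ω - X n ω))) P := fun n hn h =>
    (indepFun_of_indep_comap (hX n).measurable (hind n hn)).integrable_exp_of_add (hmeas n)
      ((hmeas (n + 1)).sub (hmeas n)) (by simpa using h)
  have hall : ∀ n, n ≤ N → Integrable (fun ω => Real.exp (t * X n ω)) P := fun n hn => by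
    induction hn using Nat.decreasingInduction with
    | self => exact hf_int
    | of_succ n hn ih => exact (hstep n hn ih).1
  exact ⟨hall, fun n hn => (hstep n hn (hall (n + 1) hn)).2⟩

lemma memLp_two_exp {Z : Ω → ℝ} (hZ : Measurable Z) {t : ℝ}
    (hf_int : Integrable (fun ω => Real.exp (2 * t * Z ω)) P) :
    MemLp (fun ω => Real.exp (t * Z ω)) 2 P := by
  refine (memLp_two_iff_integrable_sq
    (by fun_prop : Measurable fun ω => Real.exp (t * Z ω)).aestronglyMeasurable).2 ?_
  refine hf_int.congr (ae_of_all _ fun ω => ?_)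
  simp only [sq, ← Real.exp_add]
  congr 1
  ring

lemma integral_exp_two_mul_sub_sq_ne_zero_s10 [IsProbabilityMeasure P] {Z : Ω → ℝ}
    (hZ : MemLp (fun ω => Real.exp (Z ω)) 2 P) (hconst : ¬ ∃ c : ℝ, Z =ᵐ[P] fun _ => c) :
    (∫ ω, Real.exp (2 * Z ω) ∂P) - (∫ ω, Real.exp (Z ω) ∂P) ^ 2 ≠ 0 := by
  intro h0
  have hvar : Var[fun ω => Real.exp (Z ω); P] = 0 := by
    rw [variance_eq_sub hZ, ← h0]
    congr 2
    ext ω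
    simp only [Pi.pow_apply, sq, ← Real.exp_add]
    congr 1
    ring
  have hevar : eVar[fun ω => Real.exp (Z ω); P] = 0 := by
    rw [← hZ.ofReal_variance_eq, hvar, ENNReal.ofReal_zero]
  have hae := (evariance_eq_zero_iff hZ.aestronglyMeasurable.aemeasurable).1 hevar
  refine hconst ⟨Real.log (∫ ω, Real.exp (Z ω) ∂P), ?_⟩
  filter_upwards [hae] with ω hω
  rw [← hω, Real.log_exp]

lemma integral_im_eq_zero {f : Ω → ℂ} (hf : ∀ ω, (f ω).im = 0) : (∫ ω, f ω ∂P).im = 0 := by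
  have hre : f = fun ω => ((f ω).re : ℂ) := by
    ext ω
    exact Complex.ext (by simp) (by simp [hf ω])
  rw [hre, integral_complex_ofReal, Complex.ofReal_im]

variable {μ : Measure ℂ} {k : ℂ → ℂ} {a b : ℝ}

/-- Multiplying an integrable kernel on a vertical strip by a weighted exponential moment. -/
lemma integrable_mul_expMoment [IsProbabilityMeasure P] (hk : Integrable k μ)
    (hre : ∀ᵐ v ∂μ, a ≤ v.re ∧ v.re ≤ b) {Z θ : Ω → ℝ} (hZ : Measurable Z)
    (hθ : Measurable θ) (ha : Integrable (fun ω => Real.exp (a * Z ω) * θ ω) P)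
    (hb : Integrable (fun ω => Real.exp (b * Z ω) * θ ω) P) :
    Integrable (fun v => k v * ∫ ω, Complex.exp (v * Z ω) * (θ ω : ℂ) ∂P) μ := by
  refine hk.mul_bdd (c := ∫ ω, (‖Real.exp (a * Z ω) * θ ω‖ + ‖Real.exp (b * Z ω) * θ ω‖) ∂P) ?_ ?_
  · refine (StronglyMeasurable.integral_prod_right ?_).aestronglyMeasurable
    exact (by fun_prop : Measurable fun q : ℂ × Ω =>
      Complex.exp (q.1 * Z q.2) * (θ q.2 : ℂ)).stronglyMeasurable
  · filter_upwards [hre] with v hv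
    refine norm_integral_le_of_norm_le (ha.norm.add hb.norm) (ae_of_all _ fun ω => ?_)
    rw [norm_mul, norm_mul, norm_mul, Complex.norm_real, ← add_mul]
    refine mul_le_mul_of_nonneg_right ?_ (norm_nonneg _)
    simpa only [Real.norm_eq_abs, Real.abs_exp] using norm_cexp_mul_ofReal_le hv (Z ω)

end Moments

/-! ### One step of the backward recursion -/

section OneStep

variable {Ω : Type*} {m0 : MeasurableSpace Ω}

/-- A kernel `k` on a vertical strip together with the hedging kernel `kξ` and the preceding
kernel `k'` obtained from it by one step of the backward recursion along the increment `Z`. -/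
structure IsBackwardStep (P : Measure Ω) (μ : Measure ℂ) (a b : ℝ) (Z : Ω → ℝ)
    (k kξ k' : ℂ → ℂ) : Prop where
  re_mem : ∀ᵐ v ∂μ, a ≤ v.re ∧ v.re ≤ b
  measurable : Measurable Z
  memLp_left : MemLp (fun ω => Real.exp (a * Z ω)) 2 P
  memLp_right : MemLp (fun ω => Real.exp (b * Z ω)) 2 P
  memLp_exp : MemLp (fun ω => Real.exp (Z ω)) 2 P
  variance_ne_zero : (∫ ω, Real.exp (2 * Z ω) ∂P) - (∫ ω, Real.exp (Z ω) ∂P) ^ 2 ≠ 0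
  integrable : Integrable k μ
  hedge_eq : ∀ᵐ v ∂μ, kξ v =
    ((∫ ω, Complex.exp (v * Z ω) * (Real.exp (Z ω) : ℂ) ∂P)
      - ((∫ ω, Real.exp (Z ω) ∂P : ℝ) : ℂ) * ∫ ω, Complex.exp (v * Z ω) ∂P)
      / (((∫ ω, Real.exp (2 * Z ω) ∂P) - (∫ ω, Real.exp (Z ω) ∂P) ^ 2 : ℝ) : ℂ) * k v
  prev_eq : ∀ᵐ v ∂μ, k' v = k v * (∫ ω, Complex.exp (v * Z ω) ∂P)
    - kξ v * ((∫ ω, Real.exp (Z ω) ∂P) - 1 : ℝ)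

namespace IsBackwardStep

variable {P : Measure Ω} {μ : Measure ℂ} {a b : ℝ} {Z : Ω → ℝ} {k kξ k' : ℂ → ℂ}

lemma memLp_value [SFinite μ] (h : IsBackwardStep P μ a b Z k kξ k') (y : ℝ) :
    MemLp (fun ω => expTransform μ k (y + Z ω)) 2 P := by
  refine ((h.memLp_left.const_mul (Real.exp (a * y))).add
    (h.memLp_right.const_mul (Real.exp (b * y)))).of_le_mul (c := ∫ v, ‖k v‖ ∂μ) ?_
    (ae_of_all _ fun ω => ?_)
  · exact ((stronglyMeasurable_expTransform h.integrable.aestronglyMeasurable).comp_measurable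
      (h.measurable.const_add y)).aestronglyMeasurable
  · refine (norm_expTransform_le h.integrable h.re_mem _).trans_eq ?_
    rw [mul_add a, mul_add b, Real.exp_add, Real.exp_add, Pi.add_apply, Real.norm_of_nonneg]
    positivity

variable [IsProbabilityMeasure P]

lemma integrable_moment (h : IsBackwardStep P μ a b Z k kξ k') :
    Integrable (fun v => k v * ∫ ω, Complex.exp (v * Z ω) ∂P) μ := by
  simpa using integrable_mul_expMoment (θ := fun _ => 1) h.integrable h.re_mem h.measurable
    measurable_const (by simpa using h.memLp_left.integrable one_le_two)
    (by simpa using h.memLp_right.integrable one_le_two)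

lemma integrable_weighted_moment (h : IsBackwardStep P μ a b Z k kξ k') :
    Integrable (fun v => k v * ∫ ω, Complex.exp (v * Z ω) * (Real.exp (Z ω) : ℂ) ∂P) μ :=
  integrable_mul_expMoment h.integrable h.re_mem h.measurable
    (Real.measurable_exp.comp h.measurable) (h.memLp_left.integrable_mul h.memLp_exp)
    (h.memLp_right.integrable_mul h.memLp_exp)

lemma integrable_hedge (h : IsBackwardStep P μ a b Z k kξ k') : Integrable kξ μ := by
  refine ((h.integrable_weighted_moment.sub (h.integrable_moment.const_mul
    ((∫ ω, Real.exp (Z ω) ∂P : ℝ) : ℂ))).div_const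
      (((∫ ω, Real.exp (2 * Z ω) ∂P) - (∫ ω, Real.exp (Z ω) ∂P) ^ 2 : ℝ) : ℂ)).congr ?_
  filter_upwards [h.hedge_eq] with v hv
  rw [hv, Pi.sub_apply]
  ring

lemma integrable_prev (h : IsBackwardStep P μ a b Z k kξ k') : Integrable k' μ := by
  refine (h.integrable_moment.sub (h.integrable_hedge.mul_const
    (((∫ ω, Real.exp (Z ω) ∂P) - 1 : ℝ) : ℂ))).congr ?_
  filter_upwards [h.prev_eq] with v hv using hv.symm

variable [SFinite μ]

lemma integral_value (h : IsBackwardStep P μ a b Z k kξ k') (y : ℝ) :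
    ∫ ω, expTransform μ k (y + Z ω) ∂P
      = expTransform μ k' y + expTransform μ kξ y * ((∫ ω, Real.exp (Z ω) ∂P) - 1 : ℝ) := by
  rw [integral_expTransform_add h.integrable h.re_mem h.measurable
    (h.memLp_left.integrable one_le_two) (h.memLp_right.integrable one_le_two)]
  simp only [expTransform]
  rw [← integral_mul_const, ← integral_add (integrable_mul_cexp h.integrable_prev h.re_mem y)
    ((integrable_mul_cexp h.integrable_hedge h.re_mem y).mul_const _)]
  refine integral_congr_ae ?_
  filter_upwards [h.prev_eq] with v hv
  rw [hv]
  ring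

lemma integral_value_mul_exp (h : IsBackwardStep P μ a b Z k kξ k') (y : ℝ) :
    ∫ ω, expTransform μ k (y + Z ω) * (Real.exp (Z ω) : ℂ) ∂P
      = expTransform μ kξ y *
          (((∫ ω, Real.exp (2 * Z ω) ∂P) - (∫ ω, Real.exp (Z ω) ∂P) ^ 2 : ℝ) : ℂ)
        + (∫ ω, expTransform μ k (y + Z ω) ∂P) * ((∫ ω, Real.exp (Z ω) ∂P : ℝ) : ℂ) := by
  rw [integral_expTransform_add_mul (θ := fun ω => Real.exp (Z ω)) h.integrable h.re_mem
      h.measurable (Real.measurable_exp.comp h.measurable) (h.memLp_left.integrable_mul h.memLp_exp)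
      (h.memLp_right.integrable_mul h.memLp_exp),
    integral_expTransform_add h.integrable h.re_mem h.measurable
      (h.memLp_left.integrable one_le_two) (h.memLp_right.integrable one_le_two)]
  simp only [expTransform]
  rw [← integral_mul_const, ← integral_mul_const,
    ← integral_add ((integrable_mul_cexp h.integrable_hedge h.re_mem y).mul_const _)
      ((integrable_mul_cexp h.integrable_moment h.re_mem y).mul_const _)]
  refine integral_congr_ae ?_
  filter_upwards [h.hedge_eq] with v hv
  have hne := Complex.ofReal_ne_zero.2 h.variance_ne_zero
  rw [hv]
  generalize (((∫ ω, Real.exp (2 * Z ω) ∂P) - (∫ ω, Real.exp (Z ω) ∂P) ^ 2 : ℝ) : ℂ) = q at hne ⊢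
  field_simp
  ring

lemma integral_hedgingError (h : IsBackwardStep P μ a b Z k kξ k') (y : ℝ) :
    ∫ ω, (expTransform μ k (y + Z ω) - expTransform μ k' y
      - expTransform μ kξ y * (Real.exp (Z ω) - 1 : ℝ)) ∂P = 0 := by
  have hA := (h.memLp_value y).integrable one_le_two
  have hE : Integrable (fun ω => ((Real.exp (Z ω) - 1 : ℝ) : ℂ)) P :=
    ((h.memLp_exp.integrable one_le_two).sub (integrable_const 1)).ofReal
  have hA' : Integrable (fun ω => expTransform μ k (y + Z ω) - expTransform μ k' y) P :=
    hA.sub (integrable_const _)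
  rw [integral_sub hA' (hE.const_mul _), integral_sub hA (integrable_const _),
    integral_const_mul, integral_complex_ofReal,
    integral_sub (h.memLp_exp.integrable one_le_two) (integrable_const 1), h.integral_value y]
  simp

lemma integral_hedgingError_mul_exp (h : IsBackwardStep P μ a b Z k kξ k') (y : ℝ) :
    ∫ ω, (expTransform μ k (y + Z ω) - expTransform μ k' y
      - expTransform μ kξ y * (Real.exp (Z ω) - 1 : ℝ)) * (Real.exp (Z ω) : ℂ) ∂P = 0 := by
  have hsq : Integrable (fun ω => Real.exp (2 * Z ω)) P := by
    refine h.memLp_exp.integrable_sq.congr (ae_of_all _ fun ω => ?_)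
    simp only [sq, ← Real.exp_add]
    congr 1
    ring
  have hexp := h.memLp_exp.integrable one_le_two
  have hA : Integrable (fun ω => expTransform μ k (y + Z ω) * (Real.exp (Z ω) : ℂ)) P :=
    (h.memLp_value y).integrable_mul h.memLp_exp.ofReal
  have hC : Integrable (fun ω => (expTransform μ kξ y - expTransform μ k' y) *
      (Real.exp (Z ω) : ℂ)) P := hexp.ofReal.const_mul _
  have hQ : Integrable (fun ω => expTransform μ kξ y * ((Real.exp (2 * Z ω) : ℝ) : ℂ)) P :=
    hsq.ofReal.const_mul _
  have hAC : Integrable (fun ω => expTransform μ k (y + Z ω) * (Real.exp (Z ω) : ℂ)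
      + (expTransform μ kξ y - expTransform μ k' y) * (Real.exp (Z ω) : ℂ)) P := hA.add hC
  have heq : (fun ω => (expTransform μ k (y + Z ω) - expTransform μ k' y
      - expTransform μ kξ y * (Real.exp (Z ω) - 1 : ℝ)) * (Real.exp (Z ω) : ℂ))
      = fun ω => expTransform μ k (y + Z ω) * (Real.exp (Z ω) : ℂ)
        + (expTransform μ kξ y - expTransform μ k' y) * (Real.exp (Z ω) : ℂ)
        - expTransform μ kξ y * ((Real.exp (2 * Z ω) : ℝ) : ℂ) := by
    ext ω
    rw [two_mul, Real.exp_add]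
    push_cast
    ring
  rw [heq, integral_sub hAC hQ, integral_add hA hC, integral_const_mul, integral_const_mul,
    integral_complex_ofReal, integral_complex_ofReal, h.integral_value_mul_exp y,
    h.integral_value y]
  push_cast
  ring

lemma hedge_im_eq_zero (h : IsBackwardStep P μ a b Z k kξ k')
    (hreal : ∀ y, (expTransform μ k y).im = 0) (y : ℝ) : (expTransform μ kξ y).im = 0 := by
  have h1 : (∫ ω, expTransform μ k (y + Z ω) ∂P).im = 0 :=
    integral_im_eq_zero fun ω => hreal _
  have h2 : (∫ ω, expTransform μ k (y + Z ω) * (Real.exp (Z ω) : ℂ) ∂P).im = 0 :=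
    integral_im_eq_zero fun ω => by rw [Complex.im_mul_ofReal, hreal, zero_mul]
  rw [h.integral_value_mul_exp y, Complex.add_im, Complex.im_mul_ofReal, Complex.im_mul_ofReal,
    h1, zero_mul, add_zero] at h2
  exact (mul_eq_zero.1 h2).resolve_right h.variance_ne_zero

lemma prev_im_eq_zero (h : IsBackwardStep P μ a b Z k kξ k')
    (hreal : ∀ y, (expTransform μ k y).im = 0) (y : ℝ) : (expTransform μ k' y).im = 0 := by
  have h1 : (∫ ω, expTransform μ k (y + Z ω) ∂P).im = 0 :=
    integral_im_eq_zero fun ω => hreal _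
  rwa [h.integral_value y, Complex.add_im, Complex.im_mul_ofReal, h.hedge_im_eq_zero hreal y,
    zero_mul, add_zero] at h1

end IsBackwardStep

end OneStep

/-- Discrete FS decomposition of Laplace-type contingent claims.  Under
Assumptions A and B, the claim `H = f(S_N)` with `f(s) = ∫_ℂ s^z Π(dz)` admits the real
discrete Föllmer–Schweizer decomposition `H = H₀ + Σ_{k=1}^N ξ^H_k ΔS_k + L^H_N`, where
`H_n = ∫_ℂ H(z)_n Π(dz)`, `ξ^H_n = ∫_ℂ ξ(z)_n Π(dz)` and
`L^H_n = ∫_ℂ L(z)_n Π(dz) = H_n − H₀ − Σ_{k=1}^n ξ^H_k ΔS_k`; moreover the processes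
`(H_n)`, `(ξ^H_n)`, `(L^H_n)` are real-valued, `ξ^H` is predictable, `L^H` is a
square-integrable martingale with `E[L^H_0] = 0`, and `L^H · M` is a martingale.
`Π(dz) = w(z) μ(dz)` with `μ` finite and `w` integrable; the decomposition ingredients carry
the convention that they vanish when `2 Re(z) ∉ D`. -/
theorem stmt_10 {Ω : Type*} {m0 : MeasurableSpace Ω} (P : Measure Ω) [IsProbabilityMeasure P]
    (N : ℕ) (hN : 1 ≤ N) (𝓕 : Filtration ℕ m0)
    (X : ℕ → Ω → ℝ) (hXmeas : ∀ n, Measurable (X n)) (hX0 : ∀ ω, X 0 ω = 0)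
    (hXadapted : StronglyAdapted 𝓕 X)
    (hindep : iIndepFun
      (fun (k : Fin N) (ω : Ω) => X (k.val + 1) ω - X k.val ω) P)
    (hindep𝓕 : ∀ n, 1 ≤ n → n ≤ N →
      Indep (𝓕 (n - 1))
        (MeasurableSpace.comap (fun ω => X n ω - X (n - 1) ω) inferInstance) P)
    (s0 : ℝ) (hs0 : 0 < s0)
    (S : ℕ → Ω → ℝ) (hS : ∀ n ω, S n ω = s0 * Real.exp (X n ω))
    (D : Set ℂ)
    (hD : D = {w : ℂ | Integrable (fun ω => Complex.exp (w * X N ω)) P})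
    -- Assumption A
    (hA1 : ∀ n, 1 ≤ n → n ≤ N →
      ¬ ∃ c : ℝ, (fun ω => X n ω - X (n - 1) ω) =ᵐ[P] fun _ => c)
    (hA2 : (2 : ℂ) ∈ D)
    -- the finite complex measure Π(dz) = w(z) μ(dz) and Assumption B
    (μ : Measure ℂ) [IsFiniteMeasure μ] (w : ℂ → ℂ) (hw : Integrable w μ)
    (I₀ : Set ℝ) (hI₀ : IsCompact I₀)
    (h2I₀ : ∀ x ∈ I₀, ((2 * x : ℝ) : ℂ) ∈ D)
    (hconc : ∀ᵐ z ∂μ, z.re ∈ I₀)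
    -- the payoff function f is real-valued
    (hreal : ∀ s : ℝ, 0 < s → (∫ v, (s : ℂ) ^ v * w v ∂μ).im = 0)
    -- the decomposition ingredients (with the vanishing convention)
    (m : ℂ → ℕ → ℂ)
    (hm : ∀ v n, m v n = ∫ ω, Complex.exp (v * (X n ω - X (n - 1) ω)) ∂P)
    (g : ℂ → ℕ → ℂ)
    (hg : ∀ v n, ((2 * v.re : ℝ) : ℂ) ∈ D →
      g v n = (m (v + 1) n - m 1 n * m v n) / (m 2 n - (m 1 n) ^ 2))
    (hg0 : ∀ v n, ((2 * v.re : ℝ) : ℂ) ∉ D → g v n = 0)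
    (h : ℂ → ℕ → ℂ)
    (hh : ∀ v n, ((2 * v.re : ℝ) : ℂ) ∈ D →
      h v n = ∏ i ∈ Finset.Icc (n + 1) N, (m v i - g v i * (m 1 i - 1)))
    (hh0 : ∀ v n, ((2 * v.re : ℝ) : ℂ) ∉ D → h v n = 0)
    (Hz : ℂ → ℕ → Ω → ℂ)
    (hHz : ∀ v n ω, ((2 * v.re : ℝ) : ℂ) ∈ D → Hz v n ω = h v n * (S n ω : ℂ) ^ v)
    (hHz0 : ∀ v n ω, ((2 * v.re : ℝ) : ℂ) ∉ D → Hz v n ω = 0)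
    (ξz : ℂ → ℕ → Ω → ℂ)
    (hξz : ∀ v n ω, ((2 * v.re : ℝ) : ℂ) ∈ D →
      ξz v n ω = g v n * h v n * (S (n - 1) ω : ℂ) ^ (v - 1))
    (hξz0 : ∀ v n ω, ((2 * v.re : ℝ) : ℂ) ∉ D → ξz v n ω = 0)
    (Lz : ℂ → ℕ → Ω → ℂ)
    (hLz : ∀ v n ω, Lz v n ω = Hz v n ω - Hz v 0 ω -
        ∑ k ∈ Finset.Icc 1 n, ξz v k ω * ((S k ω : ℂ) - (S (k - 1) ω : ℂ)))
    -- the integrated processes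
    (Hn : ℕ → Ω → ℂ) (hHn : ∀ n ω, Hn n ω = ∫ v, Hz v n ω * w v ∂μ)
    (ξH : ℕ → Ω → ℂ) (hξH : ∀ n ω, ξH n ω = ∫ v, ξz v n ω * w v ∂μ)
    (LH : ℕ → Ω → ℂ) (hLH : ∀ n ω, LH n ω = ∫ v, Lz v n ω * w v ∂μ)
    -- the Doob decomposition martingale part of S
    (M : ℕ → Ω → ℝ)
    (hM : ∀ n ω, M n ω = S n ω -
        ∑ k ∈ Finset.Icc 1 n,
          condExp (𝓕 (k - 1)) P (fun ω' => S k ω' - S (k - 1) ω') ω) :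
    -- terminal value: H_N = H = f(S_N)
    (∀ᵐ ω ∂P, Hn N ω = ∫ v, (S N ω : ℂ) ^ v * w v ∂μ)
    -- the processes are real-valued
    ∧ (∀ n, n ≤ N → ∀ᵐ ω ∂P, (Hn n ω).im = 0)
    ∧ (∀ n, 1 ≤ n → n ≤ N → ∀ᵐ ω ∂P, (ξH n ω).im = 0)
    ∧ (∀ n, n ≤ N → ∀ᵐ ω ∂P, (LH n ω).im = 0)
    -- decomposition identity L^H_n = H_n − H₀ − Σ_{k=1}^n ξ^H_k ΔS_k
    ∧ (∀ n, n ≤ N → ∀ᵐ ω ∂P,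
        LH n ω = Hn n ω - Hn 0 ω -
          ∑ k ∈ Finset.Icc 1 n, ξH k ω * ((S k ω : ℂ) - (S (k - 1) ω : ℂ)))
    -- ξ^H is predictable
    ∧ (∀ n, 1 ≤ n → n ≤ N → StronglyMeasurable[𝓕 (n - 1)] (ξH n))
    -- L^H is a square-integrable martingale with E[L^H_0] = 0
    ∧ (∀ n, n ≤ N → MemLp (LH n) 2 P)
    ∧ (∀ n, n ≤ N → StronglyMeasurable[𝓕 n] (LH n))
    ∧ (∀ i j, i ≤ j → j ≤ N → condExp (𝓕 i) P (LH j) =ᵐ[P] LH i)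
    ∧ (∫ ω, LH 0 ω ∂P = 0)
    -- L^H · M is a martingale
    ∧ (∀ i j, i ≤ j → j ≤ N →
        condExp (𝓕 i) P (fun ω => LH j ω * (M j ω : ℂ))
          =ᵐ[P] fun ω => LH i ω * (M i ω : ℂ))
    -- the FS decomposition of H = f(S_N)
    ∧ (∀ᵐ ω ∂P,
        (∫ v, (S N ω : ℂ) ^ v * w v ∂μ)
          = Hn 0 ω + ∑ k ∈ Finset.Icc 1 N, ξH k ω * ((S k ω : ℂ) - (S (k - 1) ω : ℂ))
            + LH N ω) := by
  have hY : ∀ n ω, S n ω = Real.exp (Real.log s0 + X n ω) := fun n ω => by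
    rw [hS, Real.exp_add, Real.exp_log hs0]
  set Y : ℕ → Ω → ℝ := fun n ω => Real.log s0 + X n ω with hYdef
  have hincr : ∀ n ω, Y (n + 1) ω - Y n ω = X (n + 1) ω - X n ω := fun n ω => by
    simp only [hYdef]; ring
  have hYmeas : ∀ n, Measurable (Y n) := fun n => (hXmeas n).const_add _
  have hΔmeas : ∀ n, Measurable fun ω => Y (n + 1) ω - Y n ω := fun n =>
    (hYmeas (n + 1)).sub (hYmeas n)
  have hindepX : ∀ n, n < N →
      Indep (𝓕 n) (MeasurableSpace.comap (fun ω => X (n + 1) ω - X n ω) inferInstance) P :=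
    fun n hn => by simpa using hindep𝓕 (n + 1) (by omega) hn
  -- exponential moments
  have hDreal : ∀ t : ℝ, (t : ℂ) ∈ D → Integrable (fun ω => Real.exp (t * X N ω)) P := by
    intro t ht
    rw [hD] at ht
    refine ht.norm.congr (ae_of_all _ fun ω => ?_)
    simp [Complex.norm_exp]
  have hprice : ∀ t : ℝ, ((2 * t : ℝ) : ℂ) ∈ D → ∀ n, n ≤ N →
      MemLp (fun ω => Real.exp (t * Y n ω)) 2 P := fun t ht n hn => by
    refine ((memLp_two_exp (hXmeas n) ((integrable_exp_of_terminal hXadapted hindepX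
      (hDreal _ ht)).1 n hn)).const_mul (Real.exp (t * Real.log s0))).ae_eq
      (ae_of_all _ fun ω => ?_)
    simp only [hYdef, mul_add, Real.exp_add]
  have hreturn : ∀ t : ℝ, ((2 * t : ℝ) : ℂ) ∈ D → ∀ n, n < N →
      MemLp (fun ω => Real.exp (t * (Y (n + 1) ω - Y n ω))) 2 P := fun t ht n hn => by
    refine memLp_two_exp (hΔmeas n) ?_
    simp only [hincr]
    exact (integrable_exp_of_terminal hXadapted hindepX (hDreal _ ht)).2 n hn
  have hone : ((2 * (1 : ℝ) : ℝ) : ℂ) ∈ D := by simpa using hA2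
  have hreturn1 : ∀ n, n < N → MemLp (fun ω => Real.exp (Y (n + 1) ω - Y n ω)) 2 P :=
    fun n hn => by simpa using hreturn 1 hone n hn
  -- the strip carrying the measure
  obtain ⟨a, b, ha, hb, hab⟩ : ∃ a b : ℝ, ((2 * a : ℝ) : ℂ) ∈ D ∧ ((2 * b : ℝ) : ℂ) ∈ D ∧
      ∀ x ∈ I₀, a ≤ x ∧ x ≤ b := by
    rcases I₀.eq_empty_or_nonempty with hemp | hne
    · refine ⟨0, 0, ?_, ?_, by simp [hemp]⟩ <;> simp [hD]
    · exact ⟨sInf I₀, sSup I₀, h2I₀ _ (hI₀.sInf_mem hne), h2I₀ _ (hI₀.sSup_mem hne),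
        fun x hx => ⟨csInf_le hI₀.bddBelow hx, le_csSup hI₀.bddAbove hx⟩⟩
  have hre : ∀ᵐ v ∂μ, a ≤ v.re ∧ v.re ≤ b := hconc.mono fun v hv => hab _ hv
  have hvD : ∀ᵐ v ∂μ, ((2 * v.re : ℝ) : ℂ) ∈ D := hconc.mono fun v hv => h2I₀ _ hv
  -- the moment functions in terms of the log-price increments
  have hmY : ∀ v n, m v (n + 1) = ∫ ω, Complex.exp (v * ((Y (n + 1) ω - Y n ω : ℝ) : ℂ)) ∂P :=
    fun v n => by simp [hm, hincr]
  have hm1 : ∀ n, m 1 (n + 1) = ((∫ ω, Real.exp (Y (n + 1) ω - Y n ω) ∂P : ℝ) : ℂ) := fun n => by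
    rw [hmY, ← integral_complex_ofReal]
    simp only [one_mul, Complex.ofReal_exp]
  have hm2 : ∀ n, m 2 (n + 1) = ((∫ ω, Real.exp (2 * (Y (n + 1) ω - Y n ω)) ∂P : ℝ) : ℂ) :=
    fun n => by
      rw [hmY, ← integral_complex_ofReal]
      simp only [Complex.ofReal_exp, Complex.ofReal_mul, Complex.ofReal_ofNat]
  have hmadd : ∀ v n, m (v + 1) (n + 1) = ∫ ω, Complex.exp (v * ((Y (n + 1) ω - Y n ω : ℝ) : ℂ))
      * (Real.exp (Y (n + 1) ω - Y n ω) : ℂ) ∂P := fun v n => by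
    rw [hmY]
    simp only [add_mul, one_mul, Complex.exp_add, Complex.ofReal_exp]
  -- the backward recursion for the kernels
  have hstepOf : ∀ n, n < N → Integrable (fun v => h v (n + 1) * w v) μ →
      IsBackwardStep P μ a b (fun ω => Y (n + 1) ω - Y n ω) (fun v => h v (n + 1) * w v)
        (fun v => g v (n + 1) * h v (n + 1) * w v) (fun v => h v n * w v) := fun n hn hf_int =>
    { re_mem := hre
      measurable := hΔmeas n
      memLp_left := hreturn a ha n hn
      memLp_right := hreturn b hb n hn
      memLp_exp := hreturn1 n hn
      variance_ne_zero := by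
        refine integral_exp_two_mul_sub_sq_ne_zero_s10 (hreturn1 n hn) ?_
        simpa [hincr] using hA1 (n + 1) (by omega) hn
      integrable := hf_int
      hedge_eq := by
        filter_upwards [hvD] with v hv
        rw [hg v (n + 1) hv, hmadd, hm1, hm2, ← hmY v n]
        push_cast
        ring
      prev_eq := by
        filter_upwards [hvD] with v hv
        have hrec : h v n = (m v (n + 1) - g v (n + 1) * (m 1 (n + 1) - 1)) * h v (n + 1) := by
          rw [hh v n hv, hh v (n + 1) hv, ← Finset.insert_Icc_succ_left_eq_Icc hn,
            Finset.prod_insert (by simp)]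
          rfl
        rw [hrec, ← hmY v n, hm1]
        push_cast
        ring }
  have hterm : (fun v => h v N * w v) =ᵐ[μ] w := by
    filter_upwards [hvD] with v hv
    simp [hh v N hv]
  have hkint : ∀ n, n ≤ N → Integrable (fun v => h v n * w v) μ := fun n hn => by
    induction hn using Nat.decreasingInduction with
    | self => exact hw.congr hterm.symm
    | of_succ n hn ih => exact (hstepOf n hn ih).integrable_prev
  have hstep := fun n (hn : n < N) => hstepOf n hn (hkint (n + 1) hn)
  set A : ℕ → ℝ → ℂ := fun n => expTransform μ fun v => h v n * w v with hAdef
  set G : ℕ → ℝ → ℂ := fun n => expTransform μ fun v => g v n * h v n * w v with hGdef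
  have hmemLp : ∀ k : ℂ → ℂ, Integrable k μ → ∀ n, n ≤ N →
      MemLp (fun ω => expTransform μ k (Y n ω)) 2 P := fun k hk n hn => by
    refine ((hprice a ha n hn).add (hprice b hb n hn)).of_le_mul (c := ∫ v, ‖k v‖ ∂μ) ?_
      (ae_of_all _ fun ω => ?_)
    · exact ((stronglyMeasurable_expTransform hk.aestronglyMeasurable).comp_measurable
        (hYmeas n)).aestronglyMeasurable
    · refine (norm_expTransform_le hk hre _).trans_eq ?_
      rw [Pi.add_apply, Real.norm_of_nonneg]
      positivity
  have hedge : IsOrthogonalHedge P 𝓕 N Y A G :=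
    { adapted := fun n => ((hXadapted n).measurable.const_add _).stronglyMeasurable
      indep := fun n hn => by simpa only [hincr] using hindepX n hn
      memLp_price := fun n hn => by simpa using hprice 1 hone n hn
      memLp_return := hreturn1
      measurable_value := fun n hn =>
        stronglyMeasurable_expTransform (hkint n hn).aestronglyMeasurable
      measurable_hedge := fun n hn =>
        stronglyMeasurable_expTransform (hstep n hn).integrable_hedge.aestronglyMeasurable
      memLp_value := fun n hn => hmemLp _ (hkint n hn) n hn
      memLp_hedge := fun n hn => hmemLp _ (hstep n hn).integrable_hedge n hn.le
      memLp_shift := fun n hn y => (hstep n hn).memLp_value y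
      centred := fun n hn y => (hstep n hn).integral_hedgingError y
      orthogonal := fun n hn y => (hstep n hn).integral_hedgingError_mul_exp y }
  -- powers of the price
  have hpow : ∀ (y : ℝ) (v : ℂ), ((Real.exp y : ℝ) : ℂ) ^ v = Complex.exp (v * y) := fun y v => by
    rw [Complex.cpow_def_of_ne_zero (by exact_mod_cast (Real.exp_pos y).ne'),
      ← Complex.ofReal_log (Real.exp_pos y).le, Real.log_exp, mul_comm]
  have hclaim : ∀ y : ℝ, A N y = ∫ v, ((Real.exp y : ℝ) : ℂ) ^ v * w v ∂μ := fun y => by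
    rw [hAdef]
    simp only
    rw [expTransform_congr hterm]
    simp only [expTransform, hpow, mul_comm]
  -- real-valuedness
  have hAreal : ∀ n, n ≤ N → ∀ y, (A n y).im = 0 := fun n hn => by
    induction hn using Nat.decreasingInduction with
    | self => exact fun y => by rw [hclaim]; exact hreal _ (Real.exp_pos y)
    | of_succ n hn ih => exact (hstep n hn).prev_im_eq_zero ih
  have hGreal : ∀ n, n < N → ∀ y, (G (n + 1) y).im = 0 := fun n hn =>
    (hstep n hn).hedge_im_eq_zero (hAreal (n + 1) hn)
  -- the integrated processes
  have hHzw : ∀ n ω, (fun v => Hz v n ω * w v) =ᵐ[μ]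
      fun v => h v n * w v * Complex.exp (v * (Y n ω : ℂ)) := fun n ω => by
    filter_upwards [hvD] with v hv
    rw [hHz v n ω hv, hY, hpow]
    ring
  have hξzw : ∀ n ω, (fun v => ξz v n ω * w v) =ᵐ[μ] fun v =>
      g v n * h v n * w v * Complex.exp (v * (Y (n - 1) ω : ℂ)) *
        ((Real.exp (-Y (n - 1) ω) : ℝ) : ℂ) := fun n ω => by
    filter_upwards [hvD] with v hv
    rw [hξz v n ω hv, hY, hpow, sub_mul, one_mul, sub_eq_add_neg, Complex.exp_add,
      Complex.ofReal_exp, Complex.ofReal_neg]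
    ring
  have hHnA : ∀ n ω, Hn n ω = A n (Y n ω) := fun n ω => by
    rw [hHn]
    exact integral_congr_ae (hHzw n ω)
  have hξHG : ∀ n ω, ξH n ω = G n (Y (n - 1) ω) * ((Real.exp (-Y (n - 1) ω) : ℝ) : ℂ) :=
    fun n ω => by
      rw [hξH, integral_congr_ae (hξzw n ω), integral_mul_const]
      rfl
  have hLHdecomp : ∀ n, n ≤ N → ∀ ω, LH n ω = Hn n ω - Hn 0 ω -
      ∑ k ∈ Finset.Icc 1 n, ξH k ω * ((S k ω : ℂ) - (S (k - 1) ω : ℂ)) := by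
    intro n hn ω
    have hHint : ∀ i, i ≤ N → Integrable (fun v => Hz v i ω * w v) μ := fun i hi =>
      (integrable_mul_cexp (hkint i hi) hre (Y i ω)).congr (hHzw i ω).symm
    have hξint : ∀ k ∈ Finset.Icc 1 n, Integrable (fun v => ξz v k ω * w v *
        ((S k ω : ℂ) - (S (k - 1) ω : ℂ))) μ := fun k hk => by
      obtain ⟨k, rfl⟩ : ∃ l, k = l + 1 := ⟨k - 1, by have := (Finset.mem_Icc.1 hk).1; omega⟩
      have hk' : k < N := by have := (Finset.mem_Icc.1 hk).2; omega
      exact (((integrable_mul_cexp (hstep k hk').integrable_hedge hre (Y k ω)).mul_const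
        _).congr (hξzw (k + 1) ω).symm).mul_const _
    have hLzw : (fun v => Lz v n ω * w v) = fun v => Hz v n ω * w v - Hz v 0 ω * w v -
        ∑ k ∈ Finset.Icc 1 n, ξz v k ω * w v * ((S k ω : ℂ) - (S (k - 1) ω : ℂ)) := by
      ext v
      rw [hLz, sub_mul, sub_mul, Finset.sum_mul]
      congr 1
      exact Finset.sum_congr rfl fun k _ => by ring
    have hdiff : Integrable (fun v => Hz v n ω * w v - Hz v 0 ω * w v) μ :=
      (hHint n hn).sub (hHint 0 (Nat.zero_le _))
    rw [hLH, hLzw, integral_sub hdiff (integrable_finsetSum _ hξint),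
      integral_sub (hHint n hn) (hHint 0 (Nat.zero_le _)), integral_finsetSum _ hξint, hHn, hHn]
    simp only [integral_mul_const, hξH]
  have hgain : ∀ k ω, ξH k ω * ((S k ω : ℂ) - (S (k - 1) ω : ℂ)) =
      G k (Y (k - 1) ω) * ((Real.exp (Y k ω - Y (k - 1) ω) - 1 : ℝ) : ℂ) := fun k ω => by
    rw [hξHG, hY, hY, mul_assoc, ← Complex.ofReal_sub, ← Complex.ofReal_mul, mul_sub,
      ← Real.exp_add, ← Real.exp_add, neg_add_cancel, Real.exp_zero, neg_add_eq_sub]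
  have hLHres : ∀ n, n ≤ N → LH n = hedgingResidual A G Y n := fun n hn => by
    ext ω
    rw [hLHdecomp n hn ω, hedgingResidual, hHnA, hHnA, Finset.sum_congr rfl fun k _ => hgain k ω]
  have hξreal : ∀ n, 1 ≤ n → n ≤ N → ∀ ω, (ξH n ω).im = 0 := fun n hn1 hn ω => by
    obtain ⟨n, rfl⟩ : ∃ l, n = l + 1 := ⟨n - 1, by omega⟩
    rw [hξHG, Complex.im_mul_ofReal, hGreal n hn, zero_mul]
  have hterminal : ∀ ω, Hn N ω = ∫ v, (S N ω : ℂ) ^ v * w v ∂μ := fun ω => by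
    rw [hHnA, hclaim, hY]
  refine ⟨ae_of_all _ hterminal, fun n hn => ae_of_all _ fun ω => ?_,
    fun n hn1 hn => ae_of_all _ (hξreal n hn1 hn), fun n hn => ae_of_all _ fun ω => ?_,
    fun n hn => ae_of_all _ (hLHdecomp n hn), fun n hn1 hn => ?_, fun n hn => ?_, fun n hn => ?_,
    fun i j hij hj => ?_, ?_, fun i j hij hj => ?_, ae_of_all _ fun ω => ?_⟩
  · rw [hHnA, hAreal n hn]
  · rw [hLHdecomp n hn ω, Complex.sub_im, Complex.sub_im, hHnA, hHnA, hAreal n hn,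
      hAreal 0 (Nat.zero_le _), Complex.im_sum, Finset.sum_eq_zero fun k hk => ?_]
    · simp
    · rw [Finset.mem_Icc] at hk
      rw [← Complex.ofReal_sub, Complex.im_mul_ofReal, hξreal k hk.1 (hk.2.trans hn), zero_mul]
  · obtain ⟨n, rfl⟩ : ∃ l, n = l + 1 := ⟨n - 1, by omega⟩
    have hYn : Measurable[𝓕 n] (Y n) := (hedge.adapted n).measurable
    have hξfun : ξH (n + 1) = fun ω => G (n + 1) (Y n ω) * ((Real.exp (-Y n ω) : ℝ) : ℂ) :=
      funext fun ω => hξHG (n + 1) ω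
    rw [hξfun]
    exact ((hedge.measurable_hedge n hn).comp_measurable hYn).mul
      (Complex.measurable_ofReal.comp (Real.measurable_exp.comp hYn.neg)).stronglyMeasurable
  · rw [hLHres n hn]
    exact hedge.memLp_residual hn
  · rw [hLHres n hn]
    exact hedge.stronglyMeasurable_residual hn
  · rw [hLHres j hj, hLHres i (hij.trans hj)]
    exact hedge.condExp_residual hij hj
  · rw [hLHres 0 (Nat.zero_le _)]
    simp [hedgingResidual]
  · rw [hLHres j hj, hLHres i (hij.trans hj)]
    exact hedge.condExp_residual_mul_doobMartingale hY hM hij hj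
  · rw [hLHdecomp N le_rfl ω, ← hterminal ω]
    ring
end
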